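/- arXiv:2410.09800 — 2 statements merged into one kernel-verified Lean document; each statement's English description precedes it below -/
import Mathlib

section
/- Fix valences ς = (s_1, …, s_d) of positive integers with s_1 + ⋯ + s_d = 2N. Then the family of functions { U_α : 𝔛_d → ℝ }, where α ranges over all ς-valenced link patterns, is linearly independent over ℝ in the vector space of real-valued functions on the chamber 𝔛_d = {x ∈ ℝ^d : x_1 < ⋯ < x_d}. -/
open scoped BigOperators Classical

namespace UST

/-- Partial sums of the valences: `q j = s_1 + ⋯ + s_j`. -/
def q (s : ℕ → ℕ) (j : ℕ) : ℕ := ∑ i ∈ Finset.range j, s i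

/-- The group (0-based) of the 0-based position `t ∈ {0, …, 2N−1}`:
the unique `j` with `q j ≤ t < q (j+1)`. -/
def grp (d : ℕ) (s : ℕ → ℕ) (t : ℕ) : ℕ :=
  ((Finset.range d).filter (fun j => q s (j + 1) ≤ t)).card

/-- The 0-based offset of position `t` within its group. -/
def off (d : ℕ) (s : ℕ → ℕ) (t : ℕ) : ℕ := t - q s (grp d s t)

/-- A (labeled) `N`-link pattern in left-to-right orientation: `β.1 k` and `β.2 k` are the
0-based left and right endpoints of the `k`-th link; the left endpoints increase, each link
satisfies `a_k < b_k`, the links partition `{0, …, 2N−1}`, and the pattern is noncrossing. -/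
def isLP (N : ℕ) (β : (Fin N → Fin (2 * N)) × (Fin N → Fin (2 * N))) : Prop :=
  (∀ k l : Fin N, k < l → β.1 k < β.1 l) ∧
    (∀ k, β.1 k < β.2 k) ∧
    Function.Bijective (Sum.elim β.1 β.2) ∧
    ∀ k l, ¬(β.1 k < β.1 l ∧ β.1 l < β.2 k ∧ β.2 k < β.2 l)

/-- The set of `N`-link patterns. -/
noncomputable def LP (N : ℕ) : Finset ((Fin N → Fin (2 * N)) × (Fin N → Fin (2 * N))) :=
  Finset.univ.filter (isLP N)

/-- The Dyck path of a link pattern: `path β t = #{k : a_k < t} − #{k : b_k < t}`. -/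
def path (N : ℕ) (β : (Fin N → Fin (2 * N)) × (Fin N → Fin (2 * N))) (t : ℕ) : ℤ :=
  ((Finset.univ.filter (fun k : Fin N => ((β.1 k : ℕ)) < t)).card : ℤ) -
    ((Finset.univ.filter (fun k : Fin N => ((β.2 k : ℕ)) < t)).card : ℤ)

/-- The relation `β ≥_ς α`: the Dyck path of `β` dominates that of `α` and they agree at the
group boundaries `q j`. -/
def geqVal (N d : ℕ) (s : ℕ → ℕ)
    (β α : (Fin N → Fin (2 * N)) × (Fin N → Fin (2 * N))) : Prop :=
  (∀ t, t ≤ 2 * N → path N α t ≤ path N β t) ∧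
    ∀ j, j ≤ d → path N β (q s j) = path N α (q s j)

/-- `ς`-valenced link patterns: link patterns with no link inside a single group. -/
def valenced (N d : ℕ) (s : ℕ → ℕ)
    (α : (Fin N → Fin (2 * N)) × (Fin N → Fin (2 * N))) : Prop :=
  isLP N α ∧ ∀ k, grp d s (α.1 k : ℕ) ≠ grp d s (α.2 k : ℕ)

/-- The fused symmetric kernel `𝔎` at the point `x = (x_1, …, x_d)` (0-based coordinates):
`𝔎(u,v) = 0` if `u, v` lie in the same group, and otherwise, with `u` in the earlier group
`i` at 1-based offset `m_u` and `v` in the later group `j` at 1-based offset `m_v`,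
`𝔎(u,v) = (−1)^{m_v − 1} (m_u + m_v − 1)! / (π (x_j − x_i)^{m_u + m_v})`, i.e. the mixed
partial derivative `∂_{x_i}^{m_u−1} ∂_{x_j}^{m_v−1}` of `1/(π (x_i − x_j)²)`. -/
noncomputable def ker (d : ℕ) (s : ℕ → ℕ) (x : ℕ → ℝ) (u v : ℕ) : ℝ :=
  if grp d s u = grp d s v then 0
  else
    let w : ℕ × ℕ := if grp d s u < grp d s v then (u, v) else (v, u)
    ((-1 : ℝ) ^ off d s w.2 * ((off d s w.1 + off d s w.2 + 1).factorial : ℝ)) /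
      (Real.pi * (x (grp d s w.2) - x (grp d s w.1)) ^ (off d s w.1 + off d s w.2 + 2))

/-- The Fomin-type determinant `Δ_β` with the fused kernel. -/
noncomputable def Δ (N d : ℕ) (s : ℕ → ℕ) (x : ℕ → ℝ)
    (β : (Fin N → Fin (2 * N)) × (Fin N → Fin (2 * N))) : ℝ :=
  Matrix.det (Matrix.of fun k ℓ : Fin N => ker d s x (β.1 k : ℕ) (β.2 ℓ : ℕ))

/-- The explicit basis function `U_α(x) = Σ_{β ≥_ς α} Δ_β(x)` of Theorem D.2 of the paper. -/
noncomputable def U (N d : ℕ) (s : ℕ → ℕ)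
    (α : (Fin N → Fin (2 * N)) × (Fin N → Fin (2 * N))) (x : ℕ → ℝ) : ℝ :=
  ∑ β ∈ (LP N).filter (fun β => geqVal N d s β α), Δ N d s x β

/-- The chamber `𝔛_d` of ordered configurations (using the first `d` coordinates). -/
def chamber (d : ℕ) (x : ℕ → ℝ) : Prop := ∀ i j : ℕ, i < j → j < d → x i < x j

end UST

namespace UST

/-- An ordering of all `2N` positions into `N` links; `false` marks the opener of a link and
`true` its closer. -/
abbrev Conf (N : ℕ) := Fin N × Bool ≃ Fin (2 * N)

/-- The lexicographic enumeration of the slots: opener and closer of the first link,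
opener and closer of the second link, and so on. -/
noncomputable def slotIso (N : ℕ) : Fin (2 * N) ≃o Fin N ×ₗ Bool :=
  Fintype.orderIsoFinOfCardEq _ (by
    rw [show Fintype.card (Fin N ×ₗ Bool) = Fintype.card (Fin N × Bool) from
      Fintype.card_congr ofLex]
    simp [mul_comm])

/-- The lexicographic enumeration of the slots as a plain equivalence. -/
noncomputable def slotEquiv (N : ℕ) : Fin (2 * N) ≃ Fin N × Bool :=
  (slotIso N).toEquiv.trans ofLex

/-- The sign of a configuration relative to the lexicographic order of the slots. -/
noncomputable def sgn {N : ℕ} (e : Conf N) : ℤˣ := Equiv.Perm.sign ((slotEquiv N).trans e)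

theorem slotEquiv_lt_iff {N : ℕ} (i j : Fin (2 * N)) :
    i < j ↔ (slotEquiv N i).1 < (slotEquiv N j).1 ∨
      (slotEquiv N i).1 = (slotEquiv N j).1 ∧ (slotEquiv N i).2 < (slotEquiv N j).2 := by
  rw [← (slotIso N).lt_iff_lt, Prod.Lex.lt_iff]
  rfl

theorem sgn_trans_perm {N : ℕ} (e : Conf N) (σ : Equiv.Perm (Fin (2 * N))) :
    sgn (e.trans σ) = Equiv.Perm.sign σ * sgn e := by
  unfold sgn
  rw [← Equiv.trans_assoc]
  exact Equiv.Perm.sign_trans _ _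

theorem sgn_perm_trans {N : ℕ} (e : Conf N) (τ : Equiv.Perm (Fin N × Bool)) :
    sgn (τ.trans e) = Equiv.Perm.sign τ * sgn e := by
  unfold sgn
  have h : (slotEquiv N).trans (τ.trans e) =
      (((slotEquiv N).trans τ).trans (slotEquiv N).symm).trans ((slotEquiv N).trans e) := by
    ext x; simp
  have h2 := Equiv.Perm.sign_symm_trans_trans τ (slotEquiv N).symm
  rw [Equiv.symm_symm] at h2
  rw [h, Equiv.Perm.sign_trans, h2, mul_comm]

theorem prod_prod_Ioi_eq {ι M : Type*} [LinearOrder ι] [Fintype ι] [LocallyFiniteOrderTop ι]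
    [CommMonoid M] (f : ι → ι → M) :
    ∏ i, ∏ j ∈ Finset.Ioi i, f i j = ∏ i, ∏ j, if i < j then f i j else 1 := by
  refine Finset.prod_congr rfl fun i _ => ?_
  rw [← Finset.prod_filter]
  refine Finset.prod_congr ?_ fun _ _ => rfl
  ext j; simp

/-- The product of the four differences between two links. -/
def cross {N : ℕ} (Λ : Fin (2 * N) → ℤ) (e : Conf N) (k l : Fin N) : ℤ :=
  (Λ (e (l, false)) - Λ (e (k, false))) * (Λ (e (l, false)) - Λ (e (k, true))) *
    ((Λ (e (l, true)) - Λ (e (k, false))) * (Λ (e (l, true)) - Λ (e (k, true))))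

theorem sgn_mul_vandermonde {N : ℕ} (Λ : Fin (2 * N) → ℤ) (e : Conf N) :
    ((sgn e : ℤˣ) : ℤ) * ∏ u, ∏ v ∈ Finset.Ioi u, (Λ v - Λ u) =
      (∏ k, (Λ (e (k, true)) - Λ (e (k, false)))) *
        ∏ k, ∏ l ∈ Finset.Ioi k, cross Λ e k l := by
  have h1 : ((sgn e : ℤˣ) : ℤ) * ∏ u, ∏ v ∈ Finset.Ioi u, (Λ v - Λ u) =
      ∏ i, ∏ j ∈ Finset.Ioi i,
        (Λ (e (slotEquiv N j)) - Λ (e (slotEquiv N i))) := by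
    have h := Matrix.det_permute ((slotEquiv N).trans e) (Matrix.vandermonde Λ)
    rw [Matrix.det_vandermonde] at h
    rw [show (Matrix.vandermonde Λ).submatrix ((slotEquiv N).trans e) id =
      Matrix.vandermonde (fun i => Λ (e (slotEquiv N i))) from rfl, Matrix.det_vandermonde] at h
    rw [h]; rfl
  rw [h1, prod_prod_Ioi_eq, prod_prod_Ioi_eq, ← Finset.prod_mul_distrib]
  rw [Fintype.prod_equiv (slotEquiv N) _ (fun s => ∏ j,
    if s.1 < (slotEquiv N j).1 ∨ s.1 = (slotEquiv N j).1 ∧ s.2 < (slotEquiv N j).2 then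
      Λ (e (slotEquiv N j)) - Λ (e s) else 1)
    (fun i => by simp only [slotEquiv_lt_iff])]
  simp_rw [fun s => Fintype.prod_equiv (slotEquiv N) (fun j =>
    if s.1 < (slotEquiv N j).1 ∨ s.1 = (slotEquiv N j).1 ∧ s.2 < (slotEquiv N j).2 then
      Λ (e (slotEquiv N j)) - Λ (e s) else 1) (fun s' =>
    if s.1 < s'.1 ∨ s.1 = s'.1 ∧ s.2 < s'.2 then Λ (e s') - Λ (e s) else 1) (fun j => rfl)]
  rw [Fintype.prod_prod_type]
  refine Finset.prod_congr rfl fun k _ => ?_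
  rw [Fintype.prod_bool, Fintype.prod_prod_type, Fintype.prod_prod_type,
    ← Finset.prod_mul_distrib]
  have h3 : Λ (e (k, true)) - Λ (e (k, false)) =
      ∏ l, if l = k then Λ (e (k, true)) - Λ (e (k, false)) else 1 := by simp
  rw [h3, ← Finset.prod_mul_distrib]
  refine Finset.prod_congr rfl fun l _ => ?_
  rcases lt_trichotomy k l with h | h | h
  · simp [h, h.ne', cross]; ring
  · subst h; simp
  · simp [h.ne, h.ne', not_lt.2 h.le]

theorem prod_Ioi_pos {n : ℕ} {Λ : Fin n → ℤ} (h : StrictMono Λ) :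
    0 < ∏ u, ∏ v ∈ Finset.Ioi u, (Λ v - Λ u) :=
  Finset.prod_pos fun _ _ => Finset.prod_pos fun _ hv => sub_pos.2 (h (Finset.mem_Ioi.1 hv))

theorem units_eq_one_of_mul_pos {s : ℤˣ} {a : ℤ} (ha : 0 < a) (h : 0 < (s : ℤ) * a) : s = 1 := by
  rcases Int.units_eq_one_or s with rfl | rfl
  · rfl
  · simp at h; omega

/-- The configuration of a link pattern. -/
noncomputable def confOf {N : ℕ} {β : (Fin N → Fin (2 * N)) × (Fin N → Fin (2 * N))}
    (h : isLP N β) : Conf N :=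
  Equiv.ofBijective (fun s => if s.2 then β.2 s.1 else β.1 s.1) (by
    rw [Fintype.bijective_iff_injective_and_card]
    refine ⟨?_, by simp [mul_comm]⟩
    have hi := h.2.2.1.1
    rintro ⟨k, b⟩ ⟨l, c⟩ hkl
    cases b <;> cases c <;> simp only [Bool.false_eq_true, if_true, if_false] at hkl
    · have := @hi (Sum.inl k) (Sum.inl l) hkl
      simp_all
    · have := @hi (Sum.inl k) (Sum.inr l) hkl
      simp_all
    · have := @hi (Sum.inr k) (Sum.inl l) hkl
      simp_all
    · have := @hi (Sum.inr k) (Sum.inr l) hkl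
      simp_all)

@[simp] theorem confOf_false {N : ℕ} {β : (Fin N → Fin (2 * N)) × (Fin N → Fin (2 * N))}
    (h : isLP N β) (k : Fin N) : confOf h (k, false) = β.1 k := rfl

@[simp] theorem confOf_true {N : ℕ} {β : (Fin N → Fin (2 * N)) × (Fin N → Fin (2 * N))}
    (h : isLP N β) (k : Fin N) : confOf h (k, true) = β.2 k := rfl

theorem sgn_confOf {N : ℕ} {β : (Fin N → Fin (2 * N)) × (Fin N → Fin (2 * N))}
    (h : isLP N β) : sgn (confOf h) = 1 := by
  have hΛ : StrictMono (fun u : Fin (2 * N) => ((u : ℕ) : ℤ)) := fun a b hab => by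
    simpa using hab
  refine units_eq_one_of_mul_pos (prod_Ioi_pos hΛ) ?_
  rw [sgn_mul_vandermonde]
  refine mul_pos (Finset.prod_pos fun k _ => ?_)
    (Finset.prod_pos fun k _ => Finset.prod_pos fun l hl => ?_)
  · have := h.2.1 k
    simp only [confOf_true, confOf_false, sub_pos]
    exact hΛ this
  · have h1 := h.1 k l (Finset.mem_Ioi.1 hl)
    have h2 := h.2.1 k
    have h3 := h.2.1 l
    have h4 := h.2.2.2 k l
    have h5 : β.1 l ≠ β.2 k := fun hc => by
      have := (confOf h).injective (a₁ := (l, false)) (a₂ := (k, true)) hc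
      simp at this
    have h6 : β.2 l ≠ β.2 k := fun hc => by
      have := (confOf h).injective (a₁ := (l, true)) (a₂ := (k, true)) hc
      simp at this
      exact (Finset.mem_Ioi.1 hl).ne' this
    simp only [cross, confOf_true, confOf_false]
    rw [Fin.lt_def] at h1 h2 h3
    rw [Fin.lt_def, Fin.lt_def, Fin.lt_def] at h4
    rw [Ne, Fin.ext_iff] at h5 h6
    by_cases hc : ((β.1 l : Fin (2 * N)) : ℕ) < β.2 k
    · have h7 : ((β.2 l : Fin (2 * N)) : ℕ) < β.2 k := by omega
      have e1 : (0 : ℤ) < (β.1 l : ℕ) - (β.1 k : ℕ) := by omega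
      have e2 : (0 : ℤ) < (β.2 k : ℕ) - (β.1 l : ℕ) := by omega
      have e3 : (0 : ℤ) < (β.2 l : ℕ) - (β.1 k : ℕ) := by omega
      have e4 : (0 : ℤ) < (β.2 k : ℕ) - (β.2 l : ℕ) := by omega
      have := mul_pos (mul_pos e1 e2) (mul_pos e3 e4)
      linarith
    · exact mul_pos (mul_pos (by omega) (by omega)) (mul_pos (by omega) (by omega))

/-- A link pattern is determined by its openers. -/
theorem isLP_unique {N : ℕ} {β γ : (Fin N → Fin (2 * N)) × (Fin N → Fin (2 * N))}
    (hβ : isLP N β) (hγ : isLP N γ) (h : Set.range β.1 = Set.range γ.1) : β = γ := by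
  have ha : β.1 = γ.1 := by
    have m1 : StrictMono β.1 := fun a b => hβ.1 a b
    have m2 : StrictMono γ.1 := fun a b => hγ.1 a b
    exact (StrictMono.range_inj m1 m2).1 h
  have closer : ∀ {β γ : (Fin N → Fin (2 * N)) × (Fin N → Fin (2 * N))}, isLP N β → isLP N γ →
      β.1 = γ.1 → ∀ k, ∃ l, β.2 k = γ.2 l := by
    intro β γ hβ hγ ha k
    obtain ⟨⟨l, b⟩, hl⟩ := (confOf hγ).surjective (β.2 k)
    cases b
    · exfalso
      rw [confOf_false, ← ha] at hl
      have := (confOf hβ).injective (a₁ := (l, false)) (a₂ := (k, true)) hl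
      simp at this
    · exact ⟨l, hl.symm⟩
  have key : ∀ {β γ : (Fin N → Fin (2 * N)) × (Fin N → Fin (2 * N))}, isLP N β → isLP N γ →
      β.1 = γ.1 → ∀ k, (∀ l, k < l → β.2 l = γ.2 l) → ¬ β.2 k < γ.2 k := by
    intro β γ hβ hγ ha k hk hlt
    obtain ⟨l, hl⟩ := closer hβ hγ ha k
    rcases lt_trichotomy k l with h | h | h
    · rw [← hk l h] at hl
      have := (confOf hβ).injective (a₁ := (k, true)) (a₂ := (l, true)) hl
      simp at this
      exact h.ne this
    · subst h; exact hlt.ne hl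
    · exact hγ.2.2.2 l k ⟨hγ.1 l k h, by rw [← hl, ← ha]; exact hβ.2.1 k, by rwa [← hl]⟩
  have hb : ∀ k, β.2 k = γ.2 k := by
    by_contra! hne
    obtain ⟨k0, hk0⟩ := hne
    let S := Finset.univ.filter fun k => β.2 k ≠ γ.2 k
    have hS : S.Nonempty := ⟨k0, by simpa [S] using hk0⟩
    have hm := S.max'_mem hS
    set k := S.max' hS
    have hk : ∀ l, k < l → β.2 l = γ.2 l := fun l hl => by
      by_contra hc
      exact absurd (S.le_max' l (by simpa [S] using hc)) (not_le.2 hl)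
    rcases lt_trichotomy (β.2 k) (γ.2 k) with h | h | h
    · exact key hβ hγ ha k hk h
    · exact (Finset.mem_filter.1 hm).2 h
    · exact key hγ hβ ha.symm k (fun l hl => (hk l hl).symm) h
  exact Prod.ext ha (funext hb)

/-- Any matching whose openers precede their closers can be uncrossed to a link pattern with the
same openers. -/
theorem exists_isLP {N : ℕ} (e : Conf N) (he : ∀ k, e (k, false) < e (k, true)) :
    ∃ β, isLP N β ∧ Set.range β.1 = Set.range fun k => e (k, false) := by
  let S : Finset (Conf N) := Finset.univ.filter fun f =>
    (∀ k, f (k, false) < f (k, true)) ∧ ∀ s, (e.symm (f s)).2 = s.2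
  have hS : S.Nonempty := ⟨e, by simp [S, he]⟩
  obtain ⟨f, hfS, hf⟩ := S.exists_max_image
    (fun f => ∑ k, (((f (k, true) : ℕ) : ℤ) - (f (k, false) : ℕ)) ^ 2) hS
  obtain ⟨hf1, hf2⟩ := (Finset.mem_filter.1 hfS).2
  have hnc : ∀ k l, ¬(f (k, false) < f (l, false) ∧ f (l, false) < f (k, true) ∧
      f (k, true) < f (l, true)) := by
    rintro k l ⟨h1, h2, h3⟩
    have hkl : k ≠ l := by rintro rfl; exact h1.ne rfl
    let g : Conf N := (Equiv.swap (k, true) (l, true)).trans f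
    have gk : g (k, true) = f (l, true) := by simp [g]
    have gl : g (l, true) = f (k, true) := by simp [g]
    have gf : ∀ m, g (m, false) = f (m, false) := fun m => by
      simp only [g, Equiv.trans_apply]
      rw [Equiv.swap_apply_of_ne_of_ne] <;> simp
    have gm : ∀ m, m ≠ k → m ≠ l → g (m, true) = f (m, true) := fun m h h' => by
      simp only [g, Equiv.trans_apply]
      rw [Equiv.swap_apply_of_ne_of_ne] <;> simp [h, h']
    have hg : g ∈ S := by
      refine Finset.mem_filter.2 ⟨Finset.mem_univ _, fun m => ?_, ?_⟩
      · rw [gf]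
        by_cases hmk : m = k
        · subst hmk; rw [gk]; exact h1.trans (h2.trans h3)
        · by_cases hml : m = l
          · subst hml; rw [gl]; exact h2
          · rw [gm m hmk hml]; exact hf1 m
      · rintro ⟨m, b⟩
        cases b
        · rw [gf]; exact hf2 _
        · by_cases hmk : m = k
          · subst hmk; rw [gk]; exact hf2 _
          · by_cases hml : m = l
            · subst hml; rw [gl]; exact hf2 _
            · rw [gm m hmk hml]; exact hf2 _
    have hle := hf g hg
    rw [← Finset.add_sum_erase _ _ (Finset.mem_univ k),
      ← Finset.add_sum_erase _ _ (Finset.mem_erase.2 ⟨hkl.symm, Finset.mem_univ l⟩),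
      ← Finset.add_sum_erase (a := k) Finset.univ _ (Finset.mem_univ k),
      ← Finset.add_sum_erase _ _ (Finset.mem_erase.2 ⟨hkl.symm, Finset.mem_univ l⟩)] at hle
    rw [Finset.sum_congr rfl (g := fun m => (((f (m, true) : ℕ) : ℤ) - (f (m, false) : ℕ)) ^ 2)
      (fun m hm => by
        simp only [Finset.mem_erase] at hm
        rw [gf, gm m hm.2.1 hm.1])] at hle
    rw [gk, gl, gf, gf] at hle
    have h1' : ((f (k, false) : ℕ) : ℤ) < (f (l, false) : ℕ) := by exact_mod_cast h1
    have h3' : ((f (k, true) : ℕ) : ℤ) < (f (l, true) : ℕ) := by exact_mod_cast h3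
    nlinarith [mul_pos (sub_pos.2 h1') (sub_pos.2 h3')]
  let τ := Tuple.sort fun k => f (k, false)
  have hτ : StrictMono fun k => f (τ k, false) := by
    refine (Tuple.monotone_sort fun k => f (k, false)).strictMono_of_injective ?_
    intro a b hab
    have := f.injective hab
    simpa using this
  refine ⟨(fun k => f (τ k, false), fun k => f (τ k, true)),
    ⟨fun k l h => hτ h, fun k => hf1 _, ?_, fun k l => hnc _ _⟩, ?_⟩
  · rw [Fintype.bijective_iff_injective_and_card]
    refine ⟨?_, by simp [two_mul]⟩
    rintro (k | k) (l | l) h <;> simp at h ⊢ <;> exact h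
  · ext u
    constructor
    · rintro ⟨k, rfl⟩
      refine ⟨(e.symm (f (τ k, false))).1, ?_⟩
      have := hf2 (τ k, false)
      show e (_, false) = _
      rw [show ((e.symm (f (τ k, false))).1, false) = e.symm (f (τ k, false)) from
        Prod.ext rfl this.symm]
      simp
    · rintro ⟨k, rfl⟩
      obtain ⟨⟨m, b⟩, hm⟩ := f.surjective (e (k, false))
      have := hf2 (m, b)
      rw [hm] at this
      simp at this
      subst this
      exact ⟨τ.symm m, by simp [hm]⟩

theorem q_mono (s : ℕ → ℕ) : Monotone (q s) := fun _ _ h =>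
  Finset.sum_le_sum_of_subset (Finset.range_mono h)

theorem lt_grp_iff {d : ℕ} {s : ℕ → ℕ} {t j : ℕ} (hj : j < d) :
    j < grp d s t ↔ q s (j + 1) ≤ t := by
  unfold grp
  constructor
  · intro h
    by_contra hc
    have : (Finset.range d).filter (fun j => q s (j + 1) ≤ t) ⊆ Finset.range j := by
      intro i hi
      rw [Finset.mem_filter] at hi
      rw [Finset.mem_range]
      by_contra hij
      exact hc ((q_mono s (by omega)).trans hi.2)
    have := Finset.card_le_card this
    rw [Finset.card_range] at this
    omega
  · intro h
    have : Finset.range (j + 1) ⊆ (Finset.range d).filter (fun j => q s (j + 1) ≤ t) := by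
      intro i hi
      rw [Finset.mem_range] at hi
      rw [Finset.mem_filter, Finset.mem_range]
      exact ⟨by omega, (q_mono s (by omega)).trans h⟩
    have := Finset.card_le_card this
    rw [Finset.card_range] at this
    omega

theorem grp_mono (d : ℕ) (s : ℕ → ℕ) : Monotone (grp d s) := fun _ _ h =>
  Finset.card_le_card fun i hi => by
    rw [Finset.mem_filter] at hi ⊢
    exact ⟨hi.1, hi.2.trans h⟩

theorem grp_lt {d : ℕ} {s : ℕ → ℕ} {t : ℕ} (h : t < q s d) : grp d s t < d := by
  have hd : 0 < d := by
    rcases Nat.eq_zero_or_pos d with rfl | h'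
    · simp [q] at h
    · exact h'
  by_contra hc
  have := (lt_grp_iff (d := d) (s := s) (t := t) (j := d - 1) (by omega)).1 (by omega)
  rw [Nat.sub_add_cancel hd] at this
  omega

theorem grp_lt_iff {d : ℕ} {s : ℕ → ℕ} {t j : ℕ} (hj : j ≤ d) :
    grp d s t < j ↔ t < q s j := by
  rcases j with _ | j
  · simp [q]
  · have := lt_grp_iff (d := d) (s := s) (t := t) (j := j) (by omega)
    omega

theorem card_filter_add_card_filter {N : ℕ} (e : Conf N) (P : Fin (2 * N) → Prop)
    [DecidablePred P] :
    (Finset.univ.filter fun k => P (e (k, false))).card +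
      (Finset.univ.filter fun k => P (e (k, true))).card =
      (Finset.univ.filter P).card := by
  simp only [Finset.card_filter]
  rw [← Fintype.sum_equiv e (fun s => if P (e s) then 1 else 0) _ (fun _ => rfl),
    Fintype.sum_prod_type, ← Finset.sum_add_distrib]
  refine Finset.sum_congr rfl fun k _ => ?_
  rw [Fintype.sum_bool, add_comm]

/-- Two configurations have the same number of closers in every group. -/
def SameCount {N : ℕ} (G : Fin (2 * N) → ℕ) (e f : Conf N) : Prop :=
  ∀ c, (Finset.univ.filter fun k => G (e (k, true)) = c).card =
    (Finset.univ.filter fun k => G (f (k, true)) = c).card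

theorem SameCount.opener {N : ℕ} {G : Fin (2 * N) → ℕ} {e f : Conf N} (h : SameCount G e f)
    (c : ℕ) : (Finset.univ.filter fun k => G (e (k, false)) = c).card =
      (Finset.univ.filter fun k => G (f (k, false)) = c).card := by
  have h1 := card_filter_add_card_filter e fun u => G u = c
  have h2 := card_filter_add_card_filter f fun u => G u = c
  have := h c
  omega

theorem card_filter_comp_eq {ι : Type*} [Fintype ι] {g g' : ι → ℕ}
    (h : ∀ c, (Finset.univ.filter fun k => g k = c).card =
      (Finset.univ.filter fun k => g' k = c).card) (P : ℕ → Prop) [DecidablePred P] :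
    (Finset.univ.filter fun k => P (g k)).card = (Finset.univ.filter fun k => P (g' k)).card := by
  have key : ∀ f : ι → ℕ, (∀ k, f k ∈ Finset.univ.image g ∪ Finset.univ.image g') →
      (Finset.univ.filter fun k => P (f k)).card =
        ∑ c ∈ Finset.univ.image g ∪ Finset.univ.image g',
          if P c then (Finset.univ.filter fun k => f k = c).card else 0 := by
    intro f hf
    rw [Finset.card_eq_sum_card_fiberwise (f := f)
      (t := Finset.univ.image g ∪ Finset.univ.image g') (fun k _ => hf k)]
    refine Finset.sum_congr rfl fun c _ => ?_
    rw [Finset.filter_filter]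
    split_ifs with hc
    · congr 1
      ext k
      simp only [Finset.mem_filter, Finset.mem_univ, true_and]
      exact ⟨fun h => h.2, fun h => ⟨h ▸ hc, h⟩⟩
    · rw [Finset.card_eq_zero, Finset.filter_eq_empty_iff]
      rintro k - ⟨h1, h2⟩
      exact hc (h2 ▸ h1)
  rw [key g (fun k => by simp), key g' (fun k => by simp)]
  simp only [h]

theorem SameCount.card {N : ℕ} {G : Fin (2 * N) → ℕ} {e f : Conf N} (h : SameCount G e f)
    (b : Bool) (P : ℕ → Prop) [DecidablePred P] : (Finset.univ.filter fun k => P (G (e (k, b)))).card =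
      (Finset.univ.filter fun k => P (G (f (k, b)))).card := by
  cases b
  · exact card_filter_comp_eq h.opener P
  · exact card_filter_comp_eq h P

/-- Functions with equinumerous fibres differ by a permutation of the source. -/
theorem exists_perm_of_card_fiber {ι κ : Type*} [Fintype ι] [DecidableEq κ] {f g : ι → κ}
    (h : ∀ y, (Finset.univ.filter fun x => f x = y).card =
      (Finset.univ.filter fun x => g x = y).card) :
    ∃ σ : Equiv.Perm ι, ∀ x, g (σ x) = f x := by
  have hc : ∀ y, Fintype.card {x // f x = y} = Fintype.card {x // g x = y} := fun y => by
    rw [Fintype.card_subtype, Fintype.card_subtype, h]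
  refine ⟨((Equiv.sigmaFiberEquiv f).symm.trans
    (Equiv.sigmaCongrRight fun y => Fintype.equivOfCardEq (hc y))).trans
      (Equiv.sigmaFiberEquiv g), fun x => ?_⟩
  exact (Fintype.equivOfCardEq (hc (f x)) ⟨x, rfl⟩).2

theorem SameCount.exists_perm {N : ℕ} {G : Fin (2 * N) → ℕ} {e f : Conf N}
    (h : SameCount G e f) : ∃ σ : Equiv.Perm (Fin (2 * N)), (∀ u, G (σ u) = G u) ∧
      ∀ s, (e.symm (σ (f s))).2 = s.2 := by
  have key : ∀ (e : Conf N) (c : ℕ) (b : Bool),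
      (Finset.univ.filter fun u => (G u, (e.symm u).2) = (c, b)).card =
        (Finset.univ.filter fun k => G (e (k, b)) = c).card := by
    intro e c b
    symm
    refine Finset.card_bij (fun k _ => e (k, b)) ?_ ?_ ?_
    · intro k hk
      simpa using hk
    · intro k _ l _ hkl
      simpa using hkl
    · intro u hu
      simp only [Finset.mem_filter, Finset.mem_univ, true_and, Prod.mk.injEq] at hu
      have : e ((e.symm u).1, b) = u := by rw [← hu.2]; simp
      exact ⟨(e.symm u).1, by simp [this, hu.1], this⟩
  obtain ⟨σ, hσ⟩ := exists_perm_of_card_fiber (f := fun u => (G u, (f.symm u).2))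
    (g := fun u => (G u, (e.symm u).2)) (by
      rintro ⟨c, b⟩
      rw [key, key]
      cases b
      · exact (h.opener c).symm
      · exact (h c).symm)
  simp only [Prod.mk.injEq] at hσ
  exact ⟨σ, fun u => (hσ u).1, fun s => by simpa using (hσ (f s)).2⟩

theorem SameCount.exists_isLP {N : ℕ} {G : Fin (2 * N) → ℕ} (hG : Monotone G) {e f : Conf N}
    (h : SameCount G e f) (hf : ∀ k, G (f (k, false)) < G (f (k, true))) :
    ∃ β, isLP N β ∧ Set.range β.1 = Set.range fun k => e (k, false) := by
  obtain ⟨σ, hσ, hσe⟩ := h.exists_perm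
  obtain ⟨β, hβ, hr⟩ := UST.exists_isLP (f.trans σ) fun k => hG.reflect_lt (by
    simpa [hσ] using hf k)
  refine ⟨β, hβ, hr.trans ?_⟩
  have h1 : ∀ k, e ((e.symm (σ (f (k, false)))).1, false) = σ (f (k, false)) := fun k => by
    rw [show ((e.symm (σ (f (k, false)))).1, false) = e.symm (σ (f (k, false))) from
      Prod.ext rfl (hσe (k, false)).symm]
    simp
  ext u
  constructor
  · rintro ⟨k, rfl⟩
    exact ⟨_, h1 k⟩
  · rintro ⟨k, rfl⟩
    obtain ⟨⟨m, b⟩, hm⟩ := (f.trans σ).surjective (e (k, false))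
    have := hσe (m, b)
    rw [show σ (f (m, b)) = e (k, false) from hm] at this
    simp at this
    subst this
    exact ⟨m, hm⟩

/-- The group of a position as a function on `Fin (2 * N)`. -/
def G (N d : ℕ) (s : ℕ → ℕ) (u : Fin (2 * N)) : ℕ := grp d s u

theorem G_mono (N d : ℕ) (s : ℕ → ℕ) : Monotone (G N d s) := fun _ _ h => grp_mono d s h

theorem G_lt_iff {N d : ℕ} {s : ℕ → ℕ} (u : Fin (2 * N)) {j : ℕ}
    (hj : j ≤ d) : G N d s u < j ↔ (u : ℕ) < q s j :=
  grp_lt_iff hj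

theorem G_lt {N d : ℕ} {s : ℕ → ℕ} (hsum : q s d = 2 * N) (u : Fin (2 * N)) : G N d s u < d :=
  grp_lt (by rw [hsum]; exact u.2)

theorem valenced_lt {N d : ℕ} {s : ℕ → ℕ} {α : (Fin N → Fin (2 * N)) × (Fin N → Fin (2 * N))}
    (h : valenced N d s α) (k : Fin N) :
    G N d s (α.1 k) < G N d s (α.2 k) :=
  lt_of_le_of_ne (G_mono N d s (h.1.2.1 k).le) (h.2 k)

/-- In a valenced link pattern, the closers of a group come before its openers. -/
theorem valenced_closer_lt_opener {N d : ℕ} {s : ℕ → ℕ}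
    {α : (Fin N → Fin (2 * N)) × (Fin N → Fin (2 * N))} (h : valenced N d s α) {k l : Fin N}
    (hkl : G N d s (α.1 k) = G N d s (α.2 l)) : α.2 l < α.1 k := by
  by_contra hc
  have hne : α.1 k ≠ α.2 l := fun h' => by
    have := (confOf h.1).injective (a₁ := (k, false)) (a₂ := (l, true)) h'
    simp at this
  have h1 : α.1 k < α.2 l := lt_of_le_of_ne (not_lt.1 hc) hne
  have h2 : α.2 l < α.2 k := (G_mono N d s).reflect_lt (hkl ▸ valenced_lt h k)
  have h3 : α.1 l < α.1 k := (G_mono N d s).reflect_lt (hkl ▸ valenced_lt h l)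
  exact h.1.2.2.2 l k ⟨h3, h1, h2⟩

theorem card_filter_val_lt {n t : ℕ} (ht : t ≤ n) :
    (Finset.univ.filter fun u : Fin n => (u : ℕ) < t).card = t := by
  rw [← Fintype.card_subtype]
  have := Fintype.card_congr (Fin.castLEquiv ht)
  simpa using this.symm

theorem path_eq {N : ℕ} {β : (Fin N → Fin (2 * N)) × (Fin N → Fin (2 * N))} (h : isLP N β)
    {t : ℕ} (ht : t ≤ 2 * N) : path N β t =
      t - 2 * ((Finset.univ.filter fun k : Fin N => (β.2 k : ℕ) < t).card : ℤ) := by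
  have h1 : (Finset.univ.filter fun k : Fin N => (β.1 k : ℕ) < t).card +
      (Finset.univ.filter fun k : Fin N => (β.2 k : ℕ) < t).card = t := by
    exact (card_filter_add_card_filter (confOf h) fun u => (u : ℕ) < t).trans
      (card_filter_val_lt ht)
  unfold path
  omega

theorem card_closer_lt_add {N : ℕ} {β : (Fin N → Fin (2 * N)) × (Fin N → Fin (2 * N))}
    (h : isLP N β) {t : ℕ} (ht : t ≤ 2 * N) :
    (Finset.univ.filter fun k : Fin N => (β.1 k : ℕ) < t).card +
      (Finset.univ.filter fun k : Fin N => (β.2 k : ℕ) < t).card = t :=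
  (card_filter_add_card_filter (confOf h) fun u => (u : ℕ) < t).trans (card_filter_val_lt ht)

theorem SameCount.symm {N : ℕ} {G : Fin (2 * N) → ℕ} {e f : Conf N} (h : SameCount G e f) :
    SameCount G f e := fun c => (h c).symm

theorem SameCount.trans {N : ℕ} {G : Fin (2 * N) → ℕ} {e f g : Conf N} (h : SameCount G e f)
    (h' : SameCount G f g) : SameCount G e g := fun c => (h c).trans (h' c)

theorem q_le {N d : ℕ} {s : ℕ → ℕ} (hsum : q s d = 2 * N) {j : ℕ} (hj : j ≤ d) :
    q s j ≤ 2 * N := hsum ▸ q_mono s hj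

/-- Two configurations have equal numbers of closers in every group as soon as they have equally
many closers before every group boundary. -/
theorem sameCount_of_card_lt {N d : ℕ} {s : ℕ → ℕ} (hsum : q s d = 2 * N) {e f : Conf N}
    (h : ∀ j ≤ d, (Finset.univ.filter fun k => G N d s (e (k, true)) < j).card =
      (Finset.univ.filter fun k => G N d s (f (k, true)) < j).card) :
    SameCount (G N d s) e f := by
  have key : ∀ (e : Conf N) c, (Finset.univ.filter fun k => G N d s (e (k, true)) < c + 1).card =
      (Finset.univ.filter fun k => G N d s (e (k, true)) < c).card +
        (Finset.univ.filter fun k => G N d s (e (k, true)) = c).card := by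
    intro e c
    rw [← Finset.card_union_of_disjoint]
    · congr 1
      ext k
      simp only [Finset.mem_filter, Finset.mem_univ, true_and, Finset.mem_union]
      omega
    · rw [Finset.disjoint_filter]
      omega
  intro c
  rcases lt_or_ge c d with hc | hc
  · have h1 := key e c
    have h2 := key f c
    have h3 := h (c + 1) hc
    have h4 := h c hc.le
    omega
  · rw [Finset.filter_false_of_mem, Finset.filter_false_of_mem]
    · intro k _
      exact ((G_lt hsum (f (k, true))).trans_le hc).ne
    · intro k _
      exact ((G_lt hsum (e (k, true))).trans_le hc).ne

theorem geqVal_iff {N d : ℕ} {s : ℕ → ℕ} (hsum : q s d = 2 * N)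
    {α β : (Fin N → Fin (2 * N)) × (Fin N → Fin (2 * N))} (hβ : isLP N β)
    (hα : valenced N d s α) :
    geqVal N d s β α ↔ SameCount (G N d s) (confOf hβ) (confOf hα.1) := by
  have hlt : ∀ (γ : Fin N → Fin (2 * N)) j, j ≤ d →
      (Finset.univ.filter fun k => G N d s (γ k) < j).card =
        (Finset.univ.filter fun k => (γ k : ℕ) < q s j).card := fun γ j hj => by
    simp only [G_lt_iff _ hj]
  constructor
  · intro h
    refine sameCount_of_card_lt hsum fun j hj => ?_
    refine (hlt β.2 j hj).trans (Eq.trans ?_ (hlt α.2 j hj).symm)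
    have := h.2 j hj
    rw [path_eq hβ (q_le hsum hj), path_eq hα.1 (q_le hsum hj)] at this
    omega
  · intro h
    refine ⟨fun t ht => ?_, fun j hj => ?_⟩
    · rw [path_eq hβ ht, path_eq hα.1 ht]
      have e1 := card_closer_lt_add hβ ht
      have e2 := card_closer_lt_add hα.1 ht
      set c := grp d s t with hc
      have hG : ∀ u : Fin (2 * N), (u : ℕ) < t → G N d s u ≤ c := fun u hu => grp_mono d s hu.le
      have hG' : ∀ u : Fin (2 * N), G N d s u < c → (u : ℕ) < t := fun u hu => by
        by_contra hcc
        exact absurd (grp_mono d s (not_lt.1 hcc)) (not_le.2 hu)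
      by_cases hA : ∀ k, G N d s (α.2 k) = c → (α.2 k : ℕ) < t
      · have h1 : (Finset.univ.filter fun k => (β.2 k : ℕ) < t).card ≤
            (Finset.univ.filter fun k => G N d s (β.2 k) ≤ c).card :=
          Finset.card_le_card (Finset.monotone_filter_right _ fun k _ => hG _)
        have h2 : (Finset.univ.filter fun k => G N d s (α.2 k) ≤ c).card ≤
            (Finset.univ.filter fun k => (α.2 k : ℕ) < t).card :=
          Finset.card_le_card (Finset.monotone_filter_right _ fun k _ hk => by
            rcases hk.lt_or_eq with hk | hk
            · exact hG' _ hk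
            · exact hA k hk)
        have h3 : (Finset.univ.filter fun k => G N d s (β.2 k) ≤ c).card =
            (Finset.univ.filter fun k => G N d s (α.2 k) ≤ c).card := h.card true (· ≤ c)
        omega
      · push Not at hA
        obtain ⟨l, hl, hlt⟩ := hA
        have h1 : (Finset.univ.filter fun k => (α.1 k : ℕ) < t).card ≤
            (Finset.univ.filter fun k => G N d s (α.1 k) < c).card :=
          Finset.card_le_card (Finset.monotone_filter_right _ fun k _ hk => by
            refine (hG _ hk).lt_of_ne fun hkc => ?_
            have := valenced_closer_lt_opener hα (hkc.trans hl.symm)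
            rw [Fin.lt_def] at this
            omega)
        have h2 : (Finset.univ.filter fun k => G N d s (β.1 k) < c).card ≤
            (Finset.univ.filter fun k => (β.1 k : ℕ) < t).card :=
          Finset.card_le_card (Finset.monotone_filter_right _ fun k _ => hG' _)
        have h3 : (Finset.univ.filter fun k => G N d s (β.1 k) < c).card =
            (Finset.univ.filter fun k => G N d s (α.1 k) < c).card := h.card false (· < c)
        omega
    · rw [path_eq hβ (q_le hsum hj), path_eq hα.1 (q_le hsum hj), ← hlt _ j hj, ← hlt _ j hj]
      have h3 : (Finset.univ.filter fun k => G N d s (β.2 k) < j).card =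
          (Finset.univ.filter fun k => G N d s (α.2 k) < j).card := h.card true (· < j)
      omega

/-- Permute the openers and the closers of a configuration by two separate permutations. -/
def permuteLinks {N : ℕ} (e : Conf N) (π : Equiv.Perm (Fin N) × Equiv.Perm (Fin N)) : Conf N :=
  (Equiv.prodCongrLeft fun b : Bool => if b then π.2 else π.1).trans e

@[simp] theorem permuteLinks_false {N : ℕ} (e : Conf N) (π : Equiv.Perm (Fin N) × Equiv.Perm (Fin N))
    (k : Fin N) : permuteLinks e π (k, false) = e (π.1 k, false) := rfl

@[simp] theorem permuteLinks_true {N : ℕ} (e : Conf N) (π : Equiv.Perm (Fin N) × Equiv.Perm (Fin N))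
    (k : Fin N) : permuteLinks e π (k, true) = e (π.2 k, true) := rfl

theorem sgn_permuteLinks {N : ℕ} (e : Conf N) (π : Equiv.Perm (Fin N) × Equiv.Perm (Fin N)) :
    sgn (permuteLinks e π) = Equiv.Perm.sign π.1 * Equiv.Perm.sign π.2 * sgn e := by
  unfold permuteLinks
  rw [sgn_perm_trans, Equiv.Perm.sign_prodCongrLeft, Fintype.prod_bool]
  simp [mul_comm]

theorem sameCount_permuteLinks {N : ℕ} (G : Fin (2 * N) → ℕ) (e : Conf N)
    (π : Equiv.Perm (Fin N) × Equiv.Perm (Fin N)) : SameCount G (permuteLinks e π) e := fun c =>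
  Finset.card_equiv π.2 fun k => by
    rw [Finset.mem_filter, Finset.mem_filter, permuteLinks_true]
    simp only [Finset.mem_univ]

theorem exists_permuteLinks {N : ℕ} {e f : Conf N}
    (h : Set.range (fun k => f (k, false)) = Set.range fun k => e (k, false)) :
    ∃ π, permuteLinks f π = e := by
  have hb : ∀ s, (f.symm (e s)).2 = s.2 := by
    rintro ⟨k, b⟩
    cases b
    · obtain ⟨l, hl⟩ : e (k, false) ∈ Set.range fun k => f (k, false) := h ▸ ⟨k, rfl⟩
      simp [← hl]
    · by_contra hc
      have hc : (f.symm (e (k, true))).2 = false := by simpa using hc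
      have h1 : f ((f.symm (e (k, true))).1, false) = e (k, true) := by rw [← hc]; simp
      obtain ⟨l, hl⟩ : f ((f.symm (e (k, true))).1, false) ∈ Set.range fun k => e (k, false) :=
        h ▸ ⟨_, rfl⟩
      have := e.injective (hl.trans h1)
      simp at this
  have hbij : ∀ b, Function.Bijective fun k => (f.symm (e (k, b))).1 := fun b => by
    rw [← Finite.injective_iff_bijective]
    intro k l hkl
    have : f.symm (e (k, b)) = f.symm (e (l, b)) :=
      Prod.ext hkl ((hb (k, b)).trans (hb (l, b)).symm)
    simpa using this
  refine ⟨(Equiv.ofBijective _ (hbij false), Equiv.ofBijective _ (hbij true)), ?_⟩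
  have hr : ∀ k b, f ((f.symm (e (k, b))).1, b) = e (k, b) := fun k b => by
    rw [show ((f.symm (e (k, b))).1, b) = f.symm (e (k, b)) from Prod.ext rfl (hb (k, b)).symm]
    simp
  ext1 ⟨k, b⟩
  cases b
  · exact hr k false
  · exact hr k true

theorem permuteLinks_injective {N : ℕ} (f : Conf N) : Function.Injective (permuteLinks f) := by
  intro π π' h
  refine Prod.ext (Equiv.ext fun k => ?_) (Equiv.ext fun k => ?_)
  · simpa using congrArg (fun e : Conf N => e (k, false)) h
  · simpa using congrArg (fun e : Conf N => e (k, true)) h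

theorem range_permuteLinks_false {N : ℕ} (f : Conf N)
    (π : Equiv.Perm (Fin N) × Equiv.Perm (Fin N)) :
    (Set.range fun k => permuteLinks f π (k, false)) = Set.range fun k => f (k, false) := by
  ext u
  constructor
  · rintro ⟨k, rfl⟩
    exact ⟨π.1 k, rfl⟩
  · rintro ⟨k, rfl⟩
    exact ⟨π.1.symm k, by simp⟩

theorem factorial_mul_det {n : ℕ} (M : Matrix (Fin n) (Fin n) ℝ) :
    (n.factorial : ℝ) * M.det = ∑ π : Equiv.Perm (Fin n) × Equiv.Perm (Fin n),
      (((Equiv.Perm.sign π.1 * Equiv.Perm.sign π.2 : ℤˣ) : ℤ) : ℝ) *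
        ∏ k, M (π.1 k) (π.2 k) := by
  rw [Fintype.sum_prod_type_right]
  have : ∀ τ : Equiv.Perm (Fin n), ∑ σ : Equiv.Perm (Fin n),
      (((Equiv.Perm.sign σ * Equiv.Perm.sign τ : ℤˣ) : ℤ) : ℝ) * ∏ k, M (σ k) (τ k) = M.det := by
    intro τ
    rw [Matrix.det_apply', ← Equiv.sum_comp (Equiv.mulRight τ)]
    refine Finset.sum_congr rfl fun σ _ => ?_
    rw [← Equiv.prod_comp τ fun i => M (σ i) i]
    simp only [Equiv.coe_mulRight, Equiv.Perm.sign_mul, mul_assoc, Int.units_mul_self, mul_one,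
      Equiv.Perm.coe_mul, Function.comp_apply]
  simp only [this, Finset.sum_const, Finset.card_univ, Fintype.card_perm, Fintype.card_fin,
    nsmul_eq_mul]

/-- `U_α` as a signed sum over all configurations with the same number of closers in each group
as `α`. -/
theorem factorial_mul_U {N d : ℕ} {s : ℕ → ℕ} (hsum : q s d = 2 * N)
    {α : (Fin N → Fin (2 * N)) × (Fin N → Fin (2 * N))} (hα : valenced N d s α) (x : ℕ → ℝ) :
    (N.factorial : ℝ) * U N d s α x =
      ∑ e ∈ Finset.univ.filter fun e : Conf N => SameCount (G N d s) e (confOf hα.1),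
        ((sgn e : ℤ) : ℝ) * ∏ k, ker d s x (e (k, false) : ℕ) (e (k, true) : ℕ) := by
  have mem : ∀ {β}, β ∈ (LP N).filter (fun β => geqVal N d s β α) → isLP N β := fun hβ =>
    (Finset.mem_filter.1 (Finset.mem_filter.1 hβ).1).2
  unfold U
  rw [Finset.mul_sum]
  simp only [Δ, factorial_mul_det, Matrix.of_apply]
  rw [← Finset.sum_product']
  refine Finset.sum_bij (fun p hp => permuteLinks (confOf (mem (Finset.mem_product.1 hp).1)) p.2)
    ?_ ?_ ?_ ?_
  · intro p hp
    rw [Finset.mem_filter]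
    have hm := (Finset.mem_product.1 hp).1
    exact ⟨Finset.mem_univ _, (sameCount_permuteLinks _ _ _).trans
      ((geqVal_iff hsum (mem hm) hα).1 (Finset.mem_filter.1 hm).2)⟩
  · rintro ⟨β, π⟩ hp ⟨γ, ρ⟩ hp' h
    have hm := mem (Finset.mem_product.1 hp).1
    have hm' := mem (Finset.mem_product.1 hp').1
    have h1 := range_permuteLinks_false (confOf hm) π
    have h2 := range_permuteLinks_false (confOf hm') ρ
    have : β = γ := isLP_unique hm hm' (by
      rw [show permuteLinks (confOf hm) π = permuteLinks (confOf hm') ρ from h] at h1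
      exact h1.symm.trans h2)
    subst this
    exact Prod.ext rfl (permuteLinks_injective _ h)
  · intro e he
    have he := (Finset.mem_filter.1 he).2
    obtain ⟨β, hβ, hr⟩ := he.exists_isLP (G_mono N d s) fun k => valenced_lt hα k
    obtain ⟨π, rfl⟩ := exists_permuteLinks (f := confOf hβ) (e := e) hr
    refine ⟨(β, π), Finset.mem_product.2 ⟨Finset.mem_filter.2
      ⟨Finset.mem_filter.2 ⟨Finset.mem_univ _, hβ⟩, ?_⟩, Finset.mem_univ _⟩, rfl⟩
    exact (geqVal_iff hsum hβ hα).2 ((sameCount_permuteLinks _ _ _).symm.trans he)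
  · rintro ⟨β, π⟩ hp
    simp [sgn_permuteLinks, sgn_confOf]

/-- The coefficients in the expansion of the kernel at offsets `a`, `b`: the coefficient of
`r ^ (p + 1)`. -/
noncomputable def coef (a b p : ℕ) : ℤ :=
  ((p : ℤ) + 1) * ((descPochhammer ℤ a).eval (p : ℤ) * (descPochhammer ℤ b).eval (-(p : ℤ) - 2))

theorem coef_eq_zero {a b p : ℕ} (h : p < a) : coef a b p = 0 := by
  unfold coef
  rw [descPochhammer_eval_eq_descFactorial, Nat.descFactorial_of_lt h]
  simp

theorem coef_add (a b q : ℕ) :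
    coef a b (q + a) = (-1) ^ b * ((a + b + 1).factorial * (q + (a + b + 1)).choose (a + b + 1) :
      ℕ) := by
  have h1 : (descPochhammer ℤ b).eval (-((q + a : ℕ) : ℤ) - 2) =
      (-1) ^ b * ((q + a + 2).ascFactorial b : ℕ) := by
    have h := ascPochhammer_eval_neg_eq_descPochhammer ℤ (-((q + a : ℕ) : ℤ) - 2) b
    rw [show -(-((q + a : ℕ) : ℤ) - 2) = ((q + a + 2 : ℕ) : ℤ) by push_cast; ring,
      ← ascPochhammer_eval_cast, ascPochhammer_nat_eq_ascFactorial] at h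
    rw [h, ← mul_assoc, ← mul_pow]
    simp
  unfold coef
  rw [h1, descPochhammer_eval_eq_descFactorial]
  have h2 : (q + a + 1) * ((q + a).descFactorial a * (q + a + 2).ascFactorial b) =
      (a + b + 1).factorial * (q + (a + b + 1)).choose (a + b + 1) := by
    refine Nat.eq_of_mul_eq_mul_left (Nat.factorial_pos q) ?_
    have e1 := Nat.factorial_mul_descFactorial (n := q + a) (k := a) (by omega)
    rw [Nat.add_sub_cancel] at e1
    have e2 := Nat.factorial_mul_ascFactorial (q + a + 1) b
    have e3 := Nat.add_choose_mul_factorial_mul_factorial q (a + b + 1)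
    rw [show q + a + 1 + b = q + (a + b + 1) by ring, ← e3, Nat.factorial_succ, ← e1] at e2
    linarith
  rw [← h2]
  push_cast
  ring

theorem hasSum_coef (a b : ℕ) {r : ℝ} (hr : |r| < 1) :
    HasSum (fun p => (coef a b p : ℝ) * r ^ p)
      (r ^ a * ((-1) ^ b * ((a + b + 1).factorial : ℝ) / (1 - r) ^ (a + b + 2))) := by
  have h := (hasSum_choose_mul_geometric_of_norm_lt_one (𝕜 := ℝ) (a + b + 1) hr).mul_left
    (r ^ a * ((-1) ^ b * ((a + b + 1).factorial : ℝ)))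
  rw [← (add_left_injective a).hasSum_iff]
  · rw [mul_one_div, mul_div_assoc] at h
    refine (congrArg (HasSum · _) (funext fun q => ?_)).mpr h
    simp only [Function.comp_apply, coef_add]
    push_cast
    ring
  · intro p hp
    rw [coef_eq_zero, Int.cast_zero, zero_mul]
    by_contra hc
    exact hp ⟨p - a, Nat.sub_add_cancel (not_lt.1 hc)⟩

theorem exists_tail_bound {c : ℕ → ℝ} {f : ℝ → ℝ}
    (h : ∀ r, |r| < 1 → HasSum (fun p => c p * r ^ p) (f r)) (D : ℕ) :
    ∃ C, ∀ r, 0 ≤ r → r ≤ 1 / 2 → |f r - ∑ p ∈ Finset.range D, c p * r ^ p| ≤ C * r ^ D := by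
  have hs : Summable fun p => |c (p + D)| * (1 / 2 : ℝ) ^ p := by
    have h1 := ((h (1 / 2) (by rw [abs_of_pos] <;> norm_num)).summable.abs.comp_injective
      (add_left_injective D)).mul_left ((2 : ℝ) ^ D)
    refine h1.congr fun p => ?_
    simp only [Function.comp_apply, abs_mul, abs_pow, pow_add]
    rw [abs_of_pos (by norm_num : (0 : ℝ) < 1 / 2)]
    have : (2 : ℝ) ^ D * (1 / 2) ^ D = 1 := by rw [← mul_pow]; norm_num
    linear_combination (|c (p + D)| * (1 / 2) ^ p) * this
  refine ⟨∑' p, |c (p + D)| * (1 / 2 : ℝ) ^ p, fun r h0 h1 => ?_⟩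
  have h2 := (hasSum_nat_add_iff' D).2 (h r (by rw [abs_of_nonneg h0]; linarith))
  rw [← h2.tsum_eq, ← tsum_mul_right]
  have hle : ∀ p, ‖c (p + D) * r ^ (p + D)‖ ≤ |c (p + D)| * (1 / 2 : ℝ) ^ p * r ^ D := fun p => by
    rw [Real.norm_eq_abs, abs_mul, abs_pow, abs_of_nonneg h0, pow_add, ← mul_assoc]
    gcongr
  exact tsum_of_norm_bounded (hs.mul_right _).hasSum hle

/-- The weight difference of two groups. -/
def gap (w : ℕ → ℕ) (i j : ℕ) : ℕ := (w j - w i) + (w i - w j)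

/-- The coefficient of level `p` in the expansion of the kernel between positions `u` and `v`. -/
noncomputable def linkCoef (d : ℕ) (s : ℕ → ℕ) (u v p : ℕ) : ℤ :=
  if grp d s u = grp d s v then 0
  else if grp d s u < grp d s v then coef (off d s u) (off d s v) p
  else coef (off d s v) (off d s u) p

theorem ker_comm (d : ℕ) (s : ℕ → ℕ) (x : ℕ → ℝ) (u v : ℕ) : ker d s x u v = ker d s x v u := by
  unfold ker
  rcases lt_trichotomy (grp d s u) (grp d s v) with h | h | h
  · simp [h, h.ne, h.ne', h.not_gt]
  · simp [h]
  · simp [h, h.ne, h.ne', h.not_gt]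

theorem linkCoef_comm (d : ℕ) (s : ℕ → ℕ) (u v p : ℕ) :
    linkCoef d s u v p = linkCoef d s v u p := by
  unfold linkCoef
  rcases lt_trichotomy (grp d s u) (grp d s v) with h | h | h
  · simp [h, h.ne, h.ne', h.not_gt]
  · simp [h]
  · simp [h, h.ne, h.ne', h.not_gt]

theorem gap_comm (w : ℕ → ℕ) (i j : ℕ) : gap w i j = gap w j i := add_comm _ _

/-- The weight of a position. -/
noncomputable def wt (d : ℕ) (s w : ℕ → ℕ) (u : ℕ) : ℕ := w (grp d s u) * (off d s u + 1)

open Asymptotics Filter Topology in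
theorem ker_isBigO_of_lt {d : ℕ} {s w : ℕ → ℕ} (hw : StrictMono w) (D : ℕ) {u v : ℕ}
    (huv : grp d s u < grp d s v) :
    (fun t : ℝ => Real.pi * ker d s (fun j => (t ^ w j)⁻¹) u v / t ^ (wt d s w u + wt d s w v) -
      ∑ p ∈ Finset.range D, (linkCoef d s u v p : ℝ) * t ^ (gap w (grp d s u) (grp d s v) * (p + 1)))
      =O[𝓝[>] 0] fun t => t ^ D := by
  obtain ⟨C, hC⟩ := exists_tail_bound (fun r hr => hasSum_coef (off d s u) (off d s v) hr) D
  set a := off d s u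
  set b := off d s v
  have hγ : 1 ≤ gap w (grp d s u) (grp d s v) := by
    have := hw huv
    unfold gap
    omega
  set γ := gap w (grp d s u) (grp d s v)
  have hwγ : w (grp d s v) = w (grp d s u) + γ := by
    have := hw huv
    simp only [γ, gap]
    omega
  refine IsBigO.of_bound |C| ?_
  have hmem : Set.Ioo (0 : ℝ) (1 / 2) ∈ 𝓝[>] (0 : ℝ) := Ioo_mem_nhdsGT (by norm_num)
  filter_upwards [hmem] with t ht
  have ht0 : 0 < t := ht.1
  have htγ : t ^ γ ≤ t := pow_le_of_le_one ht0.le (by linarith [ht.2]) (by omega)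
  have htγ0 : 0 < t ^ γ := pow_pos ht0 _
  have htl : t ^ γ < 1 := by linarith [ht.2]
  have h1 : Real.pi * ker d s (fun j => (t ^ w j)⁻¹) u v / t ^ (wt d s w u + wt d s w v) =
      t ^ γ * ((t ^ γ) ^ a * ((-1) ^ b * ((a + b + 1).factorial : ℝ) /
        (1 - t ^ γ) ^ (a + b + 2))) := by
    unfold ker
    simp only [huv, huv.ne, if_true, if_false]
    rw [show off d s u = a from rfl, show off d s v = b from rfl]
    have hx : (t ^ w (grp d s v))⁻¹ - (t ^ w (grp d s u))⁻¹ =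
        (1 - t ^ γ) * (t ^ w (grp d s v))⁻¹ := by
      rw [hwγ, pow_add]
      field_simp
    have hW : t ^ (wt d s w u + wt d s w v) * (t ^ γ) ^ (a + 1) =
        (t ^ w (grp d s v)) ^ (a + b + 2) := by
      unfold wt
      rw [← pow_mul, ← pow_add, ← pow_mul, show off d s u = a from rfl,
        show off d s v = b from rfl, hwγ]
      congr 1
      ring
    have h1t : (1 - t ^ γ) ≠ 0 := by linarith
    rw [hx, mul_pow, inv_pow, ← hW]
    have := Real.pi_ne_zero
    field_simp
    ring
  have h2 : ∑ p ∈ Finset.range D, (linkCoef d s u v p : ℝ) * t ^ (γ * (p + 1)) =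
      t ^ γ * ∑ p ∈ Finset.range D, (coef a b p : ℝ) * (t ^ γ) ^ p := by
    rw [Finset.mul_sum]
    refine Finset.sum_congr rfl fun p _ => ?_
    unfold linkCoef
    rw [if_neg huv.ne, if_pos huv, mul_add, pow_add, mul_one, pow_mul]
    ring
  rw [h1, h2, ← mul_sub, Real.norm_eq_abs, abs_mul, abs_of_pos htγ0, Real.norm_eq_abs,
    abs_of_pos (pow_pos ht0 D)]
  have h3 := hC (t ^ γ) htγ0.le (by linarith [ht.2])
  calc t ^ γ * _ ≤ 1 * (C * (t ^ γ) ^ D) := by gcongr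
    _ ≤ |C| * (t ^ γ) ^ D := by
      rw [one_mul]
      gcongr
      exact le_abs_self C
    _ ≤ |C| * t ^ D := by gcongr

open Asymptotics Filter Topology in
theorem ker_isBigO {d : ℕ} {s w : ℕ → ℕ} (hw : StrictMono w) (D u v : ℕ) :
    (fun t : ℝ => Real.pi * ker d s (fun j => (t ^ w j)⁻¹) u v / t ^ (wt d s w u + wt d s w v) -
      ∑ p ∈ Finset.range D, (linkCoef d s u v p : ℝ) * t ^ (gap w (grp d s u) (grp d s v) * (p + 1)))
      =O[𝓝[>] 0] fun t => t ^ D := by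
  rcases lt_trichotomy (grp d s u) (grp d s v) with h | h | h
  · exact ker_isBigO_of_lt hw D h
  · have h1 : ∀ x, ker d s x u v = 0 := fun x => by simp [ker, h]
    have h2 : ∀ p, linkCoef d s u v p = 0 := fun p => by simp [linkCoef, h]
    simp only [h1, h2]
    simpa using isBigO_zero _ _
  · have := ker_isBigO_of_lt hw D h
    simp only [ker_comm d s _ v u, linkCoef_comm d s v u, gap_comm w (grp d s v),
      add_comm (wt d s w v)] at this
    exact this

open Asymptotics Filter Topology in
theorem isBigO_prod_sub_prod {ι X : Type*} {l : Filter X} {g : X → ℝ} {f h : ι → X → ℝ}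
    (hg : g =O[l] fun _ => (1 : ℝ)) (S : Finset ι) (hfh : ∀ i ∈ S, (fun t => f i t - h i t) =O[l] g)
    (hh : ∀ i ∈ S, h i =O[l] fun _ => (1 : ℝ)) :
    (fun t => ∏ i ∈ S, f i t - ∏ i ∈ S, h i t) =O[l] g ∧
      (fun t => ∏ i ∈ S, h i t) =O[l] fun _ => (1 : ℝ) := by
  induction S using Finset.cons_induction with
  | empty => exact ⟨by simpa using isBigO_zero _ _, by simpa using isBigO_refl (fun _ => (1 : ℝ)) l⟩
  | cons a S ha ih =>
    obtain ⟨ih1, ih2⟩ := ih (fun i hi => hfh i (Finset.mem_cons_of_mem hi))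
      fun i hi => hh i (Finset.mem_cons_of_mem hi)
    have h1 := hfh a (Finset.mem_cons_self a S)
    have h2 := hh a (Finset.mem_cons_self a S)
    simp only [Finset.prod_cons]
    constructor
    · have e1 := (h1.mul ih1).trans ((isBigO_refl g l).mul hg)
      have e2 := h1.mul ih2
      have e3 := h2.mul ih1
      simp only [mul_one, one_mul] at e1 e2 e3
      refine ((e1.add e2).add e3).congr_left fun t => ?_
      ring
    · simpa using h2.mul ih2

/-- The exponent of the leading variable attached to a configuration with levels `p`. -/
noncomputable def deg {N : ℕ} (w : ℕ → ℕ) (G : Fin (2 * N) → ℕ) (e : Conf N) (p : Fin N → ℕ) : ℕ :=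
  ∑ k, gap w (G (e (k, false))) (G (e (k, true))) * (p k + 1)

/-- The coefficient of a configuration with levels `p`. -/
noncomputable def confCoef {N : ℕ} (d : ℕ) (s : ℕ → ℕ) (e : Conf N) (p : Fin N → ℕ) : ℤ :=
  (sgn e : ℤ) * ∏ k, linkCoef d s (e (k, false) : ℕ) (e (k, true) : ℕ) (p k)

open Asymptotics Filter Topology in
/-- Expansion of `U_α` when the points escape to infinity at separated rates. -/
theorem U_isBigO {N d : ℕ} {s w : ℕ → ℕ} (hsum : q s d = 2 * N) (hw : StrictMono w) (D : ℕ)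
    {α : (Fin N → Fin (2 * N)) × (Fin N → Fin (2 * N))} (hα : valenced N d s α) :
    (fun t : ℝ => (N.factorial : ℝ) * Real.pi ^ N / t ^ (∑ u : Fin (2 * N), wt d s w u) *
        U N d s α (fun j => (t ^ w j)⁻¹) -
      ∑ e ∈ Finset.univ.filter fun e : Conf N => SameCount (G N d s) e (confOf hα.1),
        ∑ p ∈ Fintype.piFinset fun _ : Fin N => Finset.range D,
          (confCoef d s e p : ℝ) * t ^ deg w (G N d s) e p) =O[𝓝[>] 0] fun t => t ^ D := by
  have hbig : ∀ n : ℕ, (fun t : ℝ => t ^ n) =O[𝓝[>] 0] fun _ => (1 : ℝ) := fun n => by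
    refine IsBigO.of_bound 1 ?_
    have hmem : Set.Ioo (0 : ℝ) 1 ∈ 𝓝[>] (0 : ℝ) := Ioo_mem_nhdsGT one_pos
    filter_upwards [hmem] with t ht
    simpa [abs_of_pos ht.1] using pow_le_one₀ ht.1.le ht.2.le
  have key : ∀ e : Conf N, (fun t : ℝ => ((sgn e : ℤ) : ℝ) *
      (∏ k, Real.pi * ker d s (fun j => (t ^ w j)⁻¹) (e (k, false)) (e (k, true)) /
        t ^ (wt d s w (e (k, false)) + wt d s w (e (k, true))) -
      ∏ k, ∑ p ∈ Finset.range D, (linkCoef d s (e (k, false)) (e (k, true)) p : ℝ) *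
        t ^ (gap w (G N d s (e (k, false))) (G N d s (e (k, true))) * (p + 1))))
      =O[𝓝[>] 0] fun t => t ^ D := fun e => by
    refine IsBigO.const_mul_left (isBigO_prod_sub_prod (hbig D) Finset.univ
      (fun k _ => ker_isBigO hw D _ _) fun k _ => ?_).1 _
    have := IsBigO.sum (s := Finset.range D) fun p _ =>
      (hbig (gap w (G N d s (e (k, false))) (G N d s (e (k, true))) * (p + 1))).const_mul_left
        (linkCoef d s (e (k, false)) (e (k, true)) p : ℝ)
    refine this.congr_left fun t => ?_
    rw [Finset.sum_apply]
    rfl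
  have := IsBigO.sum (s := Finset.univ.filter fun e : Conf N =>
    SameCount (G N d s) e (confOf hα.1)) fun e _ => key e
  refine this.congr_left fun t => ?_
  rw [Finset.sum_apply]
  simp only [mul_sub]
  rw [Finset.sum_sub_distrib]
  congr 1
  · rw [mul_comm ((N.factorial : ℝ)), mul_div_right_comm, mul_assoc, factorial_mul_U hsum hα,
      Finset.mul_sum]
    refine Finset.sum_congr rfl fun e _ => ?_
    rw [Finset.prod_div_distrib, Finset.prod_mul_distrib, Finset.prod_const, Finset.card_univ,
      Fintype.card_fin, Finset.prod_pow_eq_pow_sum, ← Equiv.sum_comp e fun u => wt d s w u,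
      Fintype.sum_prod_type]
    simp only [Fintype.sum_bool, add_comm (wt d s w (e (_, true)))]
    ring
  · refine Finset.sum_congr rfl fun e _ => ?_
    rw [Finset.prod_univ_sum, Finset.mul_sum]
    refine Finset.sum_congr rfl fun p _ => ?_
    unfold confCoef deg
    rw [Finset.prod_mul_distrib, Finset.prod_pow_eq_pow_sum]
    push_cast
    ring

/-- The links crossing the cut between the groups `c` and `c + 1` from left to right. -/
def crossing {N : ℕ} (G : Fin (2 * N) → ℕ) (e : Conf N) (c : ℕ) : Finset (Fin N) :=
  Finset.univ.filter fun k => G (e (k, false)) ≤ c ∧ c < G (e (k, true))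

/-- The links crossing the cut between the groups `c` and `c + 1` from right to left. -/
def revCrossing {N : ℕ} (G : Fin (2 * N) → ℕ) (e : Conf N) (c : ℕ) : Finset (Fin N) :=
  Finset.univ.filter fun k => G (e (k, true)) ≤ c ∧ c < G (e (k, false))

theorem mem_crossing {N : ℕ} {G : Fin (2 * N) → ℕ} {e : Conf N} {c : ℕ} {k : Fin N} :
    k ∈ crossing G e c ↔ G (e (k, false)) ≤ c ∧ c < G (e (k, true)) := by
  simp [crossing]

theorem mem_revCrossing {N : ℕ} {G : Fin (2 * N) → ℕ} {e : Conf N} {c : ℕ} {k : Fin N} :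
    k ∈ revCrossing G e c ↔ G (e (k, true)) ≤ c ∧ c < G (e (k, false)) := by
  simp [revCrossing]

/-- Some cut is crossed from left to right by two links of the same level. -/
def Collides {N : ℕ} (G : Fin (2 * N) → ℕ) (e : Conf N) (p : Fin N → ℕ) : Prop :=
  ∃ c, ∃ kl : Fin N × Fin N, kl.1 ∈ crossing G e c ∧ kl.2 ∈ crossing G e c ∧ kl.1 ≠ kl.2 ∧
    p kl.1 = p kl.2

/-- The first cut at which two links of the same level collide. -/
noncomputable def firstCollision {N : ℕ} (G : Fin (2 * N) → ℕ) (e : Conf N) (p : Fin N → ℕ) : ℕ :=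
  sInf {c | ∃ kl : Fin N × Fin N, kl.1 ∈ crossing G e c ∧ kl.2 ∈ crossing G e c ∧ kl.1 ≠ kl.2 ∧
    p kl.1 = p kl.2}

/-- Two distinct elements of `X` with the same level, if there are any. -/
noncomputable def collidingPair {N : ℕ} (p : Fin N → ℕ) (X : Finset (Fin N)) :
    Equiv.Perm (Fin N) :=
  if h : ∃ kl : Fin N × Fin N, kl.1 ∈ X ∧ kl.2 ∈ X ∧ kl.1 ≠ kl.2 ∧ p kl.1 = p kl.2 then
    Equiv.swap h.choose.1 h.choose.2
  else 1

/-- Exchange the closers of two links of the same level colliding at the first possible cut. -/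
noncomputable def uncollide {N : ℕ} (G : Fin (2 * N) → ℕ) (p : Fin N → ℕ) (e : Conf N) : Conf N :=
  permuteLinks e (1, collidingPair p (crossing G e (firstCollision G e p)))

theorem Collides.exists_swap {N : ℕ} {G : Fin (2 * N) → ℕ} {e : Conf N} {p : Fin N → ℕ}
    (h : Collides G e p) : ∃ k l, k ≠ l ∧ p k = p l ∧
      k ∈ crossing G e (firstCollision G e p) ∧ l ∈ crossing G e (firstCollision G e p) ∧
      collidingPair p (crossing G e (firstCollision G e p)) = Equiv.swap k l := by
  have hm := Nat.sInf_mem (s := {c | ∃ kl : Fin N × Fin N, kl.1 ∈ crossing G e c ∧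
    kl.2 ∈ crossing G e c ∧ kl.1 ≠ kl.2 ∧ p kl.1 = p kl.2}) h
  change ∃ kl : Fin N × Fin N, kl.1 ∈ crossing G e (firstCollision G e p) ∧
    kl.2 ∈ crossing G e (firstCollision G e p) ∧ kl.1 ≠ kl.2 ∧ p kl.1 = p kl.2 at hm
  obtain ⟨h1, h2, h3, h4⟩ := hm.choose_spec
  refine ⟨_, _, h3, h4, h1, h2, ?_⟩
  unfold collidingPair
  rw [dif_pos hm]

theorem crossing_permuteLinks_swap {N : ℕ} {G : Fin (2 * N) → ℕ} {e : Conf N} {k l : Fin N} {c c' : ℕ}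
    (hk : k ∈ crossing G e c) (hl : l ∈ crossing G e c) (hc : c' ≤ c) :
    crossing G (permuteLinks e (1, Equiv.swap k l)) c' = crossing G e c' := by
  rw [mem_crossing] at hk hl
  ext m
  rw [mem_crossing, mem_crossing, permuteLinks_false, permuteLinks_true, Equiv.Perm.one_apply]
  by_cases h1 : m = k
  · subst h1
    rw [Equiv.swap_apply_left]
    omega
  · by_cases h2 : m = l
    · subst h2
      rw [Equiv.swap_apply_right]
      omega
    · rw [Equiv.swap_apply_of_ne_of_ne h1 h2]

theorem Collides.uncollide_involutive {N : ℕ} {G : Fin (2 * N) → ℕ} {e : Conf N} {p : Fin N → ℕ}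
    (h : Collides G e p) : Collides G (uncollide G p e) p ∧
      firstCollision G (uncollide G p e) p = firstCollision G e p ∧
      uncollide G p (uncollide G p e) = e := by
  obtain ⟨k, l, hkl, hp, hk, hl, hs⟩ := h.exists_swap
  have hcr : ∀ c' ≤ firstCollision G e p,
      crossing G (uncollide G p e) c' = crossing G e c' := fun c' hc' => by
    unfold uncollide
    rw [hs, crossing_permuteLinks_swap hk hl hc']
  have hcol : Collides G (uncollide G p e) p :=
    ⟨firstCollision G e p, (k, l), by rwa [hcr _ le_rfl], by rwa [hcr _ le_rfl], hkl, hp⟩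
  have hfirst : firstCollision G (uncollide G p e) p = firstCollision G e p := by
    apply le_antisymm
    · exact Nat.sInf_le ⟨(k, l), by rwa [hcr _ le_rfl], by rwa [hcr _ le_rfl], hkl, hp⟩
    · by_contra! hlt
      obtain ⟨k', l', hkl', hp', hk', hl', -⟩ := hcol.exists_swap
      rw [hcr _ hlt.le] at hk' hl'
      exact Nat.notMem_of_lt_sInf hlt ⟨(k', l'), hk', hl', hkl', hp'⟩
  refine ⟨hcol, hfirst, ?_⟩
  rw [uncollide, hfirst, hcr _ le_rfl, uncollide, hs]
  ext1 ⟨m, b⟩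
  cases b <;> simp

@[to_additive]
theorem prod_eq_prod_of_pair {ι M : Type*} [Fintype ι] [DecidableEq ι] [CommMonoid M]
    {f g : ι → M} {k l : ι} (hkl : k ≠ l) (h : f k * f l = g k * g l)
    (hfg : ∀ m, m ≠ k → m ≠ l → f m = g m) : ∏ m, f m = ∏ m, g m := by
  rw [← Finset.mul_prod_erase _ _ (Finset.mem_univ k), ← Finset.mul_prod_erase _ g
    (Finset.mem_univ k), ← Finset.mul_prod_erase _ _ (Finset.mem_erase.2
    ⟨hkl.symm, Finset.mem_univ l⟩), ← Finset.mul_prod_erase _ g (Finset.mem_erase.2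
    ⟨hkl.symm, Finset.mem_univ l⟩), ← mul_assoc, ← mul_assoc, h]
  congr 1
  refine Finset.prod_congr rfl fun m hm => ?_
  simp only [Finset.mem_erase] at hm
  exact hfg m hm.2.1 hm.1

theorem gap_of_lt {w : ℕ → ℕ} (hw : StrictMono w) {i j : ℕ} (h : i < j) :
    (gap w i j : ℤ) = w j - w i := by
  have := hw h
  unfold gap
  omega

theorem Collides.confCoef_uncollide {N d : ℕ} {s : ℕ → ℕ} {e : Conf N} {p : Fin N → ℕ}
    (h : Collides (G N d s) e p) :
    confCoef d s (uncollide (G N d s) p e) p = -confCoef d s e p := by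
  obtain ⟨k, l, hkl, hp, hk, hl, hs⟩ := h.exists_swap
  rw [mem_crossing] at hk hl
  have hf : ∀ {m m'}, G N d s (e (m, false)) ≤ firstCollision (G N d s) e p →
      firstCollision (G N d s) e p < G N d s (e (m', true)) → ∀ P,
      linkCoef d s (e (m, false)) (e (m', true)) P =
        coef (off d s (e (m, false))) (off d s (e (m', true))) P := fun h1 h2 P => by
    have : grp d s (e (_, false)) < grp d s (e (_, true)) := h1.trans_lt h2
    rw [linkCoef, if_neg this.ne, if_pos this]
  unfold confCoef uncollide
  rw [hs, sgn_permuteLinks, Equiv.Perm.sign_swap hkl]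
  simp only [permuteLinks_false, permuteLinks_true, Equiv.Perm.one_apply]
  rw [prod_eq_prod_of_pair (k := k) (l := l)
    (g := fun m => linkCoef d s (e (m, false)) (e (m, true)) (p m)) hkl]
  · simp
  · simp only [Equiv.swap_apply_left, Equiv.swap_apply_right]
    rw [hf hk.1 hl.2, hf hl.1 hk.2, hf hk.1 hk.2, hf hl.1 hl.2, hp]
    unfold coef
    ring
  · intro m h1 h2
    rw [Equiv.swap_apply_of_ne_of_ne h1 h2]

theorem Collides.deg_uncollide {N : ℕ} {w : ℕ → ℕ} (hw : StrictMono w) {G : Fin (2 * N) → ℕ}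
    {e : Conf N} {p : Fin N → ℕ} (h : Collides G e p) :
    deg w G (uncollide G p e) p = deg w G e p := by
  obtain ⟨k, l, hkl, hp, hk, hl, hs⟩ := h.exists_swap
  rw [mem_crossing] at hk hl
  unfold deg uncollide
  rw [hs]
  simp only [permuteLinks_false, permuteLinks_true, Equiv.Perm.one_apply]
  refine sum_eq_sum_of_pair hkl ?_ ?_
  · simp only [Equiv.swap_apply_left, Equiv.swap_apply_right]
    zify
    rw [gap_of_lt hw (hk.1.trans_lt hl.2), gap_of_lt hw (hl.1.trans_lt hk.2),
      gap_of_lt hw (hk.1.trans_lt hk.2), gap_of_lt hw (hl.1.trans_lt hl.2), hp]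
    ring
  · intro m h1 h2
    rw [Equiv.swap_apply_of_ne_of_ne h1 h2]

/-- Colliding configurations cancel. -/
theorem sum_filter_not_collides {N d : ℕ} {s w : ℕ → ℕ} (hw : StrictMono w) (f : Conf N)
    (P : Finset (Fin N → ℕ)) (t : ℝ) :
    ∑ e ∈ Finset.univ.filter fun e : Conf N => SameCount (G N d s) e f,
        ∑ p ∈ P, (confCoef d s e p : ℝ) * t ^ deg w (G N d s) e p =
      ∑ x ∈ ((Finset.univ.filter fun e : Conf N => SameCount (G N d s) e f) ×ˢ P).filter
        fun x => ¬Collides (G N d s) x.1 x.2,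
          (confCoef d s x.1 x.2 : ℝ) * t ^ deg w (G N d s) x.1 x.2 := by
  rw [← Finset.sum_product', ← Finset.sum_filter_add_sum_filter_not _
    fun x : Conf N × (Fin N → ℕ) => Collides (G N d s) x.1 x.2]
  refine add_eq_right.2 (Finset.sum_involution
    (fun x _ => (uncollide (G N d s) x.2 x.1, x.2)) ?_ ?_ ?_ ?_)
  · intro x hx
    have hc := (Finset.mem_filter.1 hx).2
    rw [hc.confCoef_uncollide, hc.deg_uncollide hw]
    push_cast
    ring
  · intro x hx hne heq
    have hc := (Finset.mem_filter.1 hx).2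
    have h1 := hc.confCoef_uncollide
    rw [show uncollide (G N d s) x.2 x.1 = x.1 from congrArg Prod.fst heq] at h1
    refine hne ?_
    rw [show confCoef d s x.1 x.2 = 0 by omega]
    simp
  · intro x hx
    have hx := Finset.mem_filter.1 hx
    have hx1 := Finset.mem_product.1 hx.1
    refine Finset.mem_filter.2 ⟨Finset.mem_product.2 ⟨Finset.mem_filter.2
      ⟨Finset.mem_univ _, ?_⟩, hx1.2⟩, hx.2.uncollide_involutive.1⟩
    exact (sameCount_permuteLinks _ _ _).trans (Finset.mem_filter.1 hx1.1).2
  · intro x hx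
    exact Prod.ext (Finset.mem_filter.1 hx).2.uncollide_involutive.2.2 rfl

theorem sum_range_card_le {T : Finset ℕ} :
    ∑ i ∈ Finset.range T.card, (i + 1) ≤ ∑ x ∈ T, (x + 1) ∧
      (∑ x ∈ T, (x + 1) = ∑ i ∈ Finset.range T.card, (i + 1) → T = Finset.range T.card) := by
  induction T using Finset.induction_on_max with
  | empty => simp
  | insert a T hT ih =>
    have ha : a ∉ T := fun h => (hT a h).false
    have hle : T.card ≤ a := by
      have : T ⊆ Finset.range a := fun x hx => Finset.mem_range.2 (hT x hx)
      simpa using Finset.card_le_card this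
    rw [Finset.sum_insert ha, Finset.card_insert_of_notMem ha, Finset.sum_range_succ]
    refine ⟨by omega, fun h => ?_⟩
    rw [Finset.range_add_one, ← ih.2 (by omega), show T.card = a by omega]

theorem gap_q (g : ℕ → ℕ) {d i j : ℕ} (hi : i ≤ d) (hj : j ≤ d) :
    gap (q g) i j = ∑ c ∈ Finset.range d,
      g c * ((if i ≤ c ∧ c < j then 1 else 0) + if j ≤ c ∧ c < i then 1 else 0) := by
  have key : ∀ i j, j ≤ d → q g j - q g i =
      ∑ c ∈ Finset.range d, g c * if i ≤ c ∧ c < j then 1 else 0 := by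
    intro i j hj
    simp only [mul_ite, mul_one, mul_zero]
    rw [← Finset.sum_filter]
    have : (Finset.range d).filter (fun c => i ≤ c ∧ c < j) = Finset.Ico i j := by
      ext c
      simp only [Finset.mem_filter, Finset.mem_range, Finset.mem_Ico]
      omega
    rw [this]
    rcases le_total i j with h | h
    · have := Finset.sum_range_add_sum_Ico g h
      unfold q
      omega
    · rw [Finset.Ico_eq_empty_of_le h, Finset.sum_empty]
      exact Nat.sub_eq_zero_of_le (q_mono g h)
  unfold gap
  rw [key i j hj, key j i hi, ← Finset.sum_add_distrib]
  simp only [mul_add]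

theorem strictMono_q {g : ℕ → ℕ} (hg : ∀ c, 0 < g c) : StrictMono (q g) :=
  strictMono_nat_of_lt_succ fun n => by
    unfold q
    rw [Finset.sum_range_succ]
    have := hg n
    omega

theorem deg_eq {N d : ℕ} (g : ℕ → ℕ) {G : Fin (2 * N) → ℕ} (hG : ∀ u, G u < d) (e : Conf N)
    (p : Fin N → ℕ) : deg (q g) G e p = ∑ c ∈ Finset.range d,
      g c * (∑ k ∈ crossing G e c, (p k + 1) + ∑ k ∈ revCrossing G e c, (p k + 1)) := by
  unfold deg
  simp only [gap_q g (hG _).le (hG _).le, Finset.sum_mul]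
  rw [Finset.sum_comm]
  refine Finset.sum_congr rfl fun c _ => ?_
  unfold crossing revCrossing
  rw [Finset.sum_filter, Finset.sum_filter, ← Finset.sum_add_distrib, Finset.mul_sum]
  refine Finset.sum_congr rfl fun k _ => ?_
  split_ifs <;> ring

/-- The number of links of `f` crossing each cut determines the least possible degree. -/
noncomputable def minDeg {N : ℕ} (d : ℕ) (g : ℕ → ℕ) (G : Fin (2 * N) → ℕ) (f : Conf N) : ℕ :=
  ∑ c ∈ Finset.range d, g c * ∑ i ∈ Finset.range (crossing G f c).card, (i + 1)

theorem card_crossing_add {N : ℕ} (G : Fin (2 * N) → ℕ) (e : Conf N) (c : ℕ) :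
    (crossing G e c).card + (Finset.univ.filter fun k => G (e (k, true)) ≤ c).card =
      (revCrossing G e c).card + (Finset.univ.filter fun k => G (e (k, false)) ≤ c).card := by
  unfold crossing revCrossing
  simp only [Finset.card_filter]
  rw [← Finset.sum_add_distrib, ← Finset.sum_add_distrib]
  refine Finset.sum_congr rfl fun k _ => ?_
  split_ifs <;> omega

theorem revCrossing_eq_empty {N : ℕ} {G : Fin (2 * N) → ℕ} {f : Conf N}
    (hf : ∀ k, G (f (k, false)) < G (f (k, true))) (c : ℕ) : revCrossing G f c = ∅ := by
  rw [Finset.eq_empty_iff_forall_notMem]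
  intro k hk
  rw [mem_revCrossing] at hk
  have := hf k
  omega

theorem SameCount.card_crossing {N : ℕ} {G : Fin (2 * N) → ℕ} {e f : Conf N}
    (h : SameCount G e f) (hf : ∀ k, G (f (k, false)) < G (f (k, true))) (c : ℕ) :
    (crossing G e c).card = (revCrossing G e c).card + (crossing G f c).card := by
  have h1 := card_crossing_add G e c
  have h2 := card_crossing_add G f c
  have h3 := h.card true (· ≤ c)
  have h4 := h.card false (· ≤ c)
  rw [revCrossing_eq_empty hf, Finset.card_empty] at h2
  omega

/-- All links point to the right, and at every cut the levels of the links crossing it are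
exactly the first natural numbers. -/
structure Good {N : ℕ} (G : Fin (2 * N) → ℕ) (e : Conf N) (p : Fin N → ℕ) : Prop where
  lt : ∀ k, G (e (k, false)) < G (e (k, true))
  image_eq : ∀ c, (crossing G e c).image p = Finset.range (crossing G e c).card

theorem injOn_of_not_collides {N : ℕ} {G : Fin (2 * N) → ℕ} {e : Conf N} {p : Fin N → ℕ}
    (h : ¬Collides G e p) (c : ℕ) : Set.InjOn p (crossing G e c) := by
  intro k hk l hl hkl
  by_contra hne
  exact h ⟨c, (k, l), hk, hl, hne, hkl⟩

theorem Good.injOn {N : ℕ} {G : Fin (2 * N) → ℕ} {e : Conf N} {p : Fin N → ℕ}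
    (h : Good G e p) (c : ℕ) : Set.InjOn p (crossing G e c) := by
  rw [← Finset.card_image_iff, h.image_eq, Finset.card_range]

theorem Good.not_collides {N : ℕ} {G : Fin (2 * N) → ℕ} {e : Conf N} {p : Fin N → ℕ}
    (h : Good G e p) : ¬Collides G e p := by
  rintro ⟨c, ⟨k, l⟩, hk, hl, hne, hkl⟩
  exact hne (h.injOn c hk hl hkl)

theorem Good.level_lt {N : ℕ} {G : Fin (2 * N) → ℕ} {e : Conf N} {p : Fin N → ℕ}
    (h : Good G e p) (k : Fin N) : p k < N := by
  have hk : k ∈ crossing G e (G (e (k, false))) := mem_crossing.2 ⟨le_rfl, h.lt k⟩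
  have h1 := Finset.mem_image_of_mem p hk
  rw [h.image_eq, Finset.mem_range] at h1
  have h2 := Finset.card_le_univ (crossing G e (G (e (k, false))))
  rw [Fintype.card_fin] at h2
  omega

theorem sum_level_add_one {N : ℕ} {p : Fin N → ℕ} {X : Finset (Fin N)} (h : Set.InjOn p X) :
    ∑ k ∈ X, (p k + 1) = ∑ x ∈ X.image p, (x + 1) := (Finset.sum_image h).symm

theorem sum_range_add_one_mono {m n : ℕ} (h : m ≤ n) :
    ∑ i ∈ Finset.range m, (i + 1) ≤ ∑ i ∈ Finset.range n, (i + 1) :=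
  Finset.sum_le_sum_of_subset (Finset.range_mono h)

theorem level_sum_le {N : ℕ} {G : Fin (2 * N) → ℕ} {e f : Conf N} {p : Fin N → ℕ}
    (hsc : SameCount G e f) (hf : ∀ k, G (f (k, false)) < G (f (k, true)))
    (h : ¬Collides G e p) (c : ℕ) :
    ∑ i ∈ Finset.range (crossing G f c).card, (i + 1) ≤ ∑ k ∈ crossing G e c, (p k + 1) := by
  have hinj := injOn_of_not_collides h c
  rw [sum_level_add_one hinj]
  refine (sum_range_add_one_mono ?_).trans sum_range_card_le.1
  rw [Finset.card_image_of_injOn hinj, hsc.card_crossing hf]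
  omega

theorem minDeg_le_deg {N d : ℕ} (g : ℕ → ℕ) {G : Fin (2 * N) → ℕ} (hG : ∀ u, G u < d)
    {e f : Conf N} {p : Fin N → ℕ} (hsc : SameCount G e f)
    (hf : ∀ k, G (f (k, false)) < G (f (k, true))) (h : ¬Collides G e p) :
    minDeg d g G f ≤ deg (q g) G e p := by
  rw [deg_eq g hG, minDeg]
  gcongr with c
  exact (level_sum_le hsc hf h c).trans (Nat.le_add_right _ _)

theorem good_of_deg_eq {N d : ℕ} {g : ℕ → ℕ} (hg : ∀ c, 0 < g c) {G : Fin (2 * N) → ℕ}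
    (hG : ∀ u, G u < d) {e f : Conf N} {p : Fin N → ℕ} (hsc : SameCount G e f)
    (hf : ∀ k, G (f (k, false)) < G (f (k, true))) (h : ¬Collides G e p)
    (hne : ∀ k, G (e (k, false)) ≠ G (e (k, true))) (hdeg : deg (q g) G e p = minDeg d g G f) :
    Good G e p := by
  rw [deg_eq g hG, minDeg] at hdeg
  have hle : ∀ c ∈ Finset.range d, g c * ∑ i ∈ Finset.range (crossing G f c).card, (i + 1) ≤
      g c * (∑ k ∈ crossing G e c, (p k + 1) + ∑ k ∈ revCrossing G e c, (p k + 1)) :=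
    fun c _ => Nat.mul_le_mul le_rfl
      ((level_sum_le hsc hf h c).trans (Nat.le_add_right _ _))
  have heq : ∀ c, c < d → ∑ k ∈ crossing G e c, (p k + 1) + ∑ k ∈ revCrossing G e c, (p k + 1) =
      ∑ i ∈ Finset.range (crossing G f c).card, (i + 1) := fun c hc =>
    (Nat.eq_of_mul_eq_mul_left (hg c)
      ((Finset.sum_eq_sum_iff_of_le hle).1 hdeg.symm c (Finset.mem_range.2 hc))).symm
  have hrev : ∀ c, revCrossing G e c = ∅ := fun c => by
    rw [Finset.eq_empty_iff_forall_notMem]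
    intro k hk
    have hc : c < d := (mem_revCrossing.1 hk).2.trans (hG _)
    have h1 := heq c hc
    have h2 := level_sum_le hsc hf h c
    have h3 : p k + 1 ≤ ∑ k ∈ revCrossing G e c, (p k + 1) :=
      Finset.single_le_sum (f := fun k => p k + 1) (fun _ _ => Nat.zero_le _) hk
    omega
  refine ⟨fun k => ?_, fun c => ?_⟩
  · by_contra hlt
    have h1 := hne k
    have : k ∈ revCrossing G e (G (e (k, true))) := mem_revCrossing.2 ⟨le_rfl, by omega⟩
    rw [hrev] at this
    simp at this
  · rcases lt_or_ge c d with hc | hc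
    · have h1 := heq c hc
      have h2 := hsc.card_crossing hf c
      have hinj := injOn_of_not_collides h c
      have hcard := Finset.card_image_of_injOn hinj
      rw [hrev, Finset.card_empty, zero_add] at h2
      rw [hrev, Finset.sum_empty, add_zero, ← h2, sum_level_add_one hinj, ← hcard] at h1
      rw [← hcard]
      exact sum_range_card_le.2 h1
    · have : crossing G e c = ∅ := by
        rw [Finset.eq_empty_iff_forall_notMem]
        intro k hk
        exact ((mem_crossing.1 hk).2.trans (hG _)).not_ge hc
      simp [this]

theorem Good.deg_eq_minDeg {N d : ℕ} (g : ℕ → ℕ) {G : Fin (2 * N) → ℕ} (hG : ∀ u, G u < d)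
    {e f : Conf N} {p : Fin N → ℕ} (h : Good G e p) (hsc : SameCount G e f)
    (hf : ∀ k, G (f (k, false)) < G (f (k, true))) : deg (q g) G e p = minDeg d g G f := by
  rw [deg_eq g hG, minDeg]
  refine Finset.sum_congr rfl fun c _ => ?_
  have h2 := hsc.card_crossing hf c
  rw [revCrossing_eq_empty h.lt, Finset.card_empty, zero_add] at h2
  rw [revCrossing_eq_empty h.lt, Finset.sum_empty, add_zero, sum_level_add_one (h.injOn c),
    h.image_eq, h2]

/-- The evaluation point attached to a position: the level `p` at an opener, its reflection
`-p - 2` at a closer. -/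
def level {N : ℕ} (e : Conf N) (p : Fin N → ℕ) (u : Fin (2 * N)) : ℤ :=
  if (e.symm u).2 then -(p (e.symm u).1 : ℤ) - 2 else p (e.symm u).1

@[simp] theorem level_false {N : ℕ} (e : Conf N) (p : Fin N → ℕ) (k : Fin N) :
    level e p (e (k, false)) = p k := by simp [level]

@[simp] theorem level_true {N : ℕ} (e : Conf N) (p : Fin N → ℕ) (k : Fin N) :
    level e p (e (k, true)) = -(p k : ℤ) - 2 := by simp [level]

/-- The levels, shifted so as to separate the groups. -/
def node {N : ℕ} (G : Fin (2 * N) → ℕ) (e : Conf N) (p : Fin N → ℕ) (u : Fin (2 * N)) : ℤ :=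
  level e p u + (2 * N + 1) * G u

theorem Good.level_bounds {N : ℕ} {G : Fin (2 * N) → ℕ} {e : Conf N} {p : Fin N → ℕ}
    (h : Good G e p) (u : Fin (2 * N)) : -(N : ℤ) - 1 ≤ level e p u ∧ level e p u < N := by
  have := h.level_lt (e.symm u).1
  unfold level
  split_ifs <;> constructor <;> omega

theorem Good.node_lt {N : ℕ} {G : Fin (2 * N) → ℕ} {e : Conf N} {p : Fin N → ℕ}
    (h : Good G e p) {u v : Fin (2 * N)} (huv : G u < G v) : node G e p u < node G e p v := by
  obtain ⟨m, hm⟩ := Nat.exists_eq_add_of_lt huv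
  have h1 := h.level_bounds u
  have h2 := h.level_bounds v
  have h3 : (0 : ℤ) ≤ (2 * N + 1) * m := by positivity
  unfold node
  rw [hm]
  push_cast
  linarith

theorem Good.node_lt_iff {N : ℕ} {G : Fin (2 * N) → ℕ} {e : Conf N} {p : Fin N → ℕ}
    (h : Good G e p) {u v : Fin (2 * N)} : node G e p u < node G e p v ↔
      G u < G v ∨ G u = G v ∧ level e p u < level e p v := by
  rcases lt_trichotomy (G u) (G v) with huv | huv | huv
  · simp [huv, h.node_lt huv]
  · simp [huv, node]
  · simp [huv.not_gt, huv.ne', (h.node_lt huv).le]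

/-- The contribution of the endpoints of `k` lying strictly inside `l`. -/
noncomputable def inner {N : ℕ} (G : Fin (2 * N) → ℕ) (e : Conf N) (p : Fin N → ℕ)
    (k l : Fin N) : ℕ :=
  if p k < p l then
    (if G (e (l, false)) < G (e (k, true)) ∧ G (e (k, true)) < G (e (l, true)) then 1 else 0) +
    (if G (e (l, false)) < G (e (k, false)) ∧ G (e (k, false)) < G (e (l, true)) then 1 else 0)
  else 0

theorem mul_neg_one_pow_pos {a b z : ℤ} {P : Prop} [Decidable P] (ha : a ≠ z) (hb : b ≠ z)
    (hab : a < b) (hP : P ↔ a < z ∧ z < b) :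
    0 < (a - z) * (b - z) * (-1) ^ (if P then 1 else 0) := by
  split_ifs with h
  · rw [hP] at h
    nlinarith [mul_pos (sub_pos.2 h.1) (sub_pos.2 h.2)]
  · rw [hP] at h
    rcases lt_or_gt_of_ne ha with h1 | h1
    · have h2 : b < z := by omega
      nlinarith [mul_pos (sub_pos.2 h1) (sub_pos.2 h2)]
    · have h2 : z < b := by omega
      nlinarith [mul_pos (sub_pos.2 h1) (sub_pos.2 h2)]

theorem cross_comm {N : ℕ} (Λ : Fin (2 * N) → ℤ) (e : Conf N) (k l : Fin N) :
    cross Λ e k l = cross Λ e l k := by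
  unfold cross
  ring

theorem Good.cross_pos_of_lt {N : ℕ} {G : Fin (2 * N) → ℕ} {e : Conf N} {p : Fin N → ℕ}
    (h : Good G e p) {k l : Fin N} (hkl : p k < p l) :
    0 < cross (node G e p) e k l * (-1) ^ inner G e p k l := by
  have hl := h.node_lt (h.lt l)
  have n1 : node G e p (e (l, false)) ≠ node G e p (e (k, true)) := fun hc => by
    have a1 := mt h.node_lt_iff.2 hc.not_lt
    have a2 := mt h.node_lt_iff.2 hc.not_gt
    simp at a1 a2
    omega
  have n2 : node G e p (e (l, true)) ≠ node G e p (e (k, true)) := fun hc => by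
    have a1 := mt h.node_lt_iff.2 hc.not_lt
    have a2 := mt h.node_lt_iff.2 hc.not_gt
    simp at a1 a2
    omega
  have n3 : node G e p (e (l, false)) ≠ node G e p (e (k, false)) := fun hc => by
    have a1 := mt h.node_lt_iff.2 hc.not_lt
    have a2 := mt h.node_lt_iff.2 hc.not_gt
    simp at a1 a2
    omega
  have n4 : node G e p (e (l, true)) ≠ node G e p (e (k, false)) := fun hc => by
    have a1 := mt h.node_lt_iff.2 hc.not_lt
    have a2 := mt h.node_lt_iff.2 hc.not_gt
    simp at a1 a2
    omega
  have h1 := mul_neg_one_pow_pos (P := G (e (l, false)) < G (e (k, true)) ∧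
      G (e (k, true)) < G (e (l, true))) n1 n2 hl (by
    rw [h.node_lt_iff, h.node_lt_iff]
    simp only [level_false, level_true]
    omega)
  have h2 := mul_neg_one_pow_pos (P := G (e (l, false)) < G (e (k, false)) ∧
      G (e (k, false)) < G (e (l, true))) n3 n4 hl (by
    rw [h.node_lt_iff, h.node_lt_iff]
    simp only [level_false, level_true]
    omega)
  have := mul_pos h1 h2
  unfold cross inner
  rw [if_pos hkl, pow_add]
  linarith

theorem Good.cross_pos {N : ℕ} {G : Fin (2 * N) → ℕ} {e : Conf N} {p : Fin N → ℕ}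
    (h : Good G e p) {k l : Fin N} (hkl : k ≠ l) :
    0 < cross (node G e p) e k l * ((-1) ^ inner G e p l k * (-1) ^ inner G e p k l) := by
  rcases lt_trichotomy (p k) (p l) with hp | hp | hp
  · have h1 : inner G e p l k = 0 := if_neg hp.not_gt
    rw [h1, pow_zero, one_mul]
    exact h.cross_pos_of_lt hp
  · have h1 : inner G e p l k = 0 := if_neg (by omega)
    have h2 : inner G e p k l = 0 := if_neg (by omega)
    rw [h1, h2, pow_zero, one_mul, mul_one]
    have key : ∀ {k l}, p k = p l → G (e (k, true)) ≤ G (e (l, false)) →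
        0 < cross (node G e p) e k l := by
      intro k l hp hkl
      have a1 := h.lt k
      have a2 := h.lt l
      have b2 : node G e p (e (k, true)) < node G e p (e (l, false)) := by
        rw [h.node_lt_iff]
        simp only [level_false, level_true]
        omega
      have b1 := (h.node_lt a1).trans b2
      have b3 := b1.trans (h.node_lt a2)
      have b4 := b2.trans (h.node_lt a2)
      exact mul_pos (mul_pos (sub_pos.2 b1) (sub_pos.2 b2)) (mul_pos (sub_pos.2 b3) (sub_pos.2 b4))
    have a1 := h.lt k
    have a2 := h.lt l
    have hd : G (e (k, true)) ≤ G (e (l, false)) ∨ G (e (l, true)) ≤ G (e (k, false)) := by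
      by_contra! hc
      refine hkl (h.injOn (max (G (e (k, false))) (G (e (l, false)))) ?_ ?_ hp) <;>
        rw [Finset.mem_coe, mem_crossing] <;> omega
    rcases hd with hd | hd
    · exact key hp hd
    · rw [cross_comm]
      exact key hp.symm hd
  · have h1 : inner G e p k l = 0 := if_neg hp.not_gt
    rw [h1, pow_zero, mul_one, cross_comm]
    exact h.cross_pos_of_lt hp

theorem Good.card_crossing_lt {N : ℕ} {G : Fin (2 * N) → ℕ} {e : Conf N} {p : Fin N → ℕ}
    (h : Good G e p) {c : ℕ} {l : Fin N} (hl : l ∈ crossing G e c) :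
    ((crossing G e c).filter fun k => p k < p l).card = p l := by
  have h1 := Finset.mem_image_of_mem p hl
  rw [h.image_eq, Finset.mem_range] at h1
  have h2 : ((crossing G e c).filter fun k => p k < p l).image p = Finset.range (p l) := by
    rw [← Finset.filter_image (s := crossing G e c) (f := p) (p := fun x => x < p l), h.image_eq]
    ext x
    simp only [Finset.mem_filter, Finset.mem_range]
    omega
  rw [← Finset.card_image_of_injOn ((h.injOn c).mono (Finset.coe_subset.2
    (Finset.filter_subset _ _))), h2, Finset.card_range]

theorem Good.even_sum_inner {N : ℕ} {G : Fin (2 * N) → ℕ} {e : Conf N} {p : Fin N → ℕ}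
    (h : Good G e p) (l : Fin N) : Even (∑ k, inner G e p k l) := by
  have hl := h.lt l
  have h1 := h.card_crossing_lt (mem_crossing.2 ⟨le_rfl, hl⟩)
  have h2 := h.card_crossing_lt (c := G (e (l, true)) - 1) (l := l)
    (mem_crossing.2 ⟨by omega, by omega⟩)
  have h3 : ((crossing G e (G (e (l, true)) - 1)).filter fun k => p k < p l).card +
      ∑ k, (if p k < p l then if G (e (l, false)) < G (e (k, true)) ∧
        G (e (k, true)) < G (e (l, true)) then 1 else 0 else 0) =
      ((crossing G e (G (e (l, false)))).filter fun k => p k < p l).card +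
      ∑ k, (if p k < p l then if G (e (l, false)) < G (e (k, false)) ∧
        G (e (k, false)) < G (e (l, true)) then 1 else 0 else 0) := by
    unfold crossing
    rw [Finset.filter_filter, Finset.filter_filter, Finset.card_filter, Finset.card_filter,
      ← Finset.sum_add_distrib, ← Finset.sum_add_distrib]
    refine Finset.sum_congr rfl fun k _ => ?_
    have := h.lt k
    split_ifs <;> omega
  rw [h1, h2, add_right_inj] at h3
  have h4 : ∑ k, inner G e p k l = ∑ k, (if p k < p l then if G (e (l, false)) < G (e (k, true)) ∧
        G (e (k, true)) < G (e (l, true)) then 1 else 0 else 0) +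
      ∑ k, (if p k < p l then if G (e (l, false)) < G (e (k, false)) ∧
        G (e (k, false)) < G (e (l, true)) then 1 else 0 else 0) := by
    rw [← Finset.sum_add_distrib]
    refine Finset.sum_congr rfl fun k _ => ?_
    unfold inner
    split_ifs <;> rfl
  rw [h4, h3]
  exact ⟨_, rfl⟩

theorem Good.prod_cross_pos {N : ℕ} {G : Fin (2 * N) → ℕ} {e : Conf N} {p : Fin N → ℕ}
    (h : Good G e p) : 0 < ∏ k, ∏ l ∈ Finset.Ioi k, cross (node G e p) e k l := by
  have h1 : 0 < ∏ k, ∏ l ∈ Finset.Ioi k, cross (node G e p) e k l *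
      ((-1) ^ inner G e p l k * (-1) ^ inner G e p k l) :=
    Finset.prod_pos fun k _ => Finset.prod_pos fun l hl => h.cross_pos (Finset.mem_Ioi.1 hl).ne
  have h2 : ∏ k, ∏ l ∈ Finset.Ioi k, ((-1 : ℤ) ^ inner G e p l k * (-1) ^ inner G e p k l) = 1 := by
    rw [Finset.prod_prod_Ioi_mul_eq_prod_prod_off_diag fun k l => (-1 : ℤ) ^ inner G e p k l]
    refine Finset.prod_eq_one fun l _ => ?_
    have h3 : inner G e p l l = 0 := if_neg (lt_irrefl _)
    have h4 := h.even_sum_inner l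
    rw [← Finset.add_sum_erase _ _ (Finset.mem_univ l), h3, zero_add] at h4
    rw [Finset.prod_pow_eq_pow_sum, Finset.compl_singleton]
    exact h4.neg_one_pow
  simp only [Finset.prod_mul_distrib] at h1 h2
  rwa [h2, mul_one] at h1

theorem Good.sgn_mul_vandermonde_pos {N : ℕ} {G : Fin (2 * N) → ℕ} {e : Conf N} {p : Fin N → ℕ}
    (h : Good G e p) :
    0 < (sgn e : ℤ) * ∏ u, ∏ v ∈ Finset.Ioi u, (node G e p v - node G e p u) := by
  rw [sgn_mul_vandermonde]
  exact mul_pos (Finset.prod_pos fun k _ => sub_pos.2 (h.node_lt (h.lt k))) h.prod_cross_pos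

theorem det_eq_of_blockTriangular {m R : Type*} [CommRing R] [Fintype m] [DecidableEq m]
    {A B : Matrix m m R} {b : m → ℕ} (hA : A.BlockTriangular b) (hB : B.BlockTriangular b)
    (h : ∀ i j, b i = b j → A i j = B i j) : A.det = B.det := by
  rw [hA.det, hB.det]
  refine Finset.prod_congr rfl fun a _ => congrArg Matrix.det ?_
  ext i j
  exact h i j (i.2.trans j.2.symm)

/-- The matrix of falling factorials of the levels, within each group. -/
noncomputable def levelMatrix {N : ℕ} (d : ℕ) (s : ℕ → ℕ) (e : Conf N) (p : Fin N → ℕ) :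
    Matrix (Fin (2 * N)) (Fin (2 * N)) ℤ :=
  Matrix.of fun u v => if G N d s u = G N d s v then
    (descPochhammer ℤ (off d s v)).eval (level e p u) else 0

theorem q_add_off {N d : ℕ} {s : ℕ → ℕ} (hsum : q s d = 2 * N) (u : Fin (2 * N)) :
    q s (G N d s u) + off d s u = u := by
  have h := (G_lt_iff (s := s) u (G_lt hsum u).le).not.1 (lt_irrefl _)
  unfold off
  unfold G at h ⊢
  omega

open Polynomial in
/-- The Vandermonde determinant of the nodes factors along the groups. -/
theorem vandermonde_node_eq {N d : ℕ} {s : ℕ → ℕ} (hsum : q s d = 2 * N) {e : Conf N}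
    {p : Fin N → ℕ} :
    ∏ u, ∏ v ∈ Finset.Ioi u, (node (G N d s) e p v - node (G N d s) e p u) =
      (∏ u, ∏ w ∈ Finset.univ.filter fun w => G N d s w < G N d s u,
        (node (G N d s) e p u - node (G N d s) e p w)) * (levelMatrix d s e p).det := by
  set x := node (G N d s) e p with hx
  let R : Fin (2 * N) → ℤ[X] := fun v =>
    (∏ w ∈ Finset.univ.filter fun w => G N d s w < G N d s v, (X - C (x w))) *
      (descPochhammer ℤ (off d s v)).comp (X - C ((2 * N + 1) * (G N d s v : ℤ)))
  have hcomp : ∀ n (z : ℤ), ((descPochhammer ℤ n).comp (X - C z)).Monic := fun n z =>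
    (monic_descPochhammer ℤ n).comp (monic_X_sub_C z) (by
      rw [natDegree_X_sub_C]
      exact one_ne_zero)
  have hm : ∀ v, (R v).Monic := fun v =>
    (monic_prod_of_monic _ _ fun w _ => monic_X_sub_C _).mul (hcomp _ _)
  have hdeg : ∀ v, (R v).natDegree = v := fun v => by
    have h1 := card_filter_val_lt (q_le hsum (G_lt hsum v).le)
    simp only [← G_lt_iff _ (G_lt hsum v).le] at h1
    rw [Monic.natDegree_mul (monic_prod_of_monic _ _ fun w _ => monic_X_sub_C _)
      (hcomp _ _), natDegree_comp,
      natDegree_X_sub_C, mul_one, descPochhammer_natDegree, natDegree_prod_of_monic _ _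
      fun w _ => monic_X_sub_C _]
    simp only [natDegree_X_sub_C, Finset.sum_const, smul_eq_mul, mul_one]
    rw [h1, q_add_off hsum]
  have hR : ∀ u v, (R v).eval (x u) =
      (∏ w ∈ Finset.univ.filter fun w => G N d s w < G N d s v, (x u - x w)) *
        (descPochhammer ℤ (off d s v)).eval (x u - (2 * N + 1) * (G N d s v : ℤ)) := fun u v => by
    simp only [R, eval_mul, eval_prod, eval_comp, eval_sub, eval_X, eval_C]
  rw [← Matrix.det_vandermonde, Matrix.det_eval_matrixOfPolynomials_eq_det_vandermonde x R hdeg hm,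
    ← Matrix.det_diagonal, ← Matrix.det_mul, ← Matrix.det_transpose,
    ← Matrix.det_transpose (Matrix.diagonal _ * _)]
  refine det_eq_of_blockTriangular (b := G N d s) (fun i j hij => ?_) (fun i j hij => ?_)
    fun i j hij => ?_
  · rw [Matrix.transpose_apply, Matrix.of_apply, hR,
      Finset.prod_eq_zero (Finset.mem_filter.2 ⟨Finset.mem_univ j, hij⟩) (sub_self _), zero_mul]
  · rw [Matrix.transpose_apply, Matrix.diagonal_mul, levelMatrix, Matrix.of_apply, if_neg hij.ne,
      mul_zero]
  · rw [Matrix.transpose_apply, Matrix.transpose_apply, Matrix.diagonal_mul, levelMatrix,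
      Matrix.of_apply, Matrix.of_apply, hR, if_pos hij.symm, hij]
    congr 2
    rw [hx, node]
    ring

theorem Good.sgn_mul_det_pos {N d : ℕ} {s : ℕ → ℕ} (hsum : q s d = 2 * N) {e : Conf N}
    {p : Fin N → ℕ} (h : Good (G N d s) e p) : 0 < (sgn e : ℤ) * (levelMatrix d s e p).det := by
  have h1 := h.sgn_mul_vandermonde_pos
  rw [vandermonde_node_eq hsum, mul_left_comm] at h1
  exact pos_of_mul_pos_right h1 (Finset.prod_nonneg fun u _ => Finset.prod_nonneg fun w hw =>
    (sub_pos.2 (h.node_lt (Finset.mem_filter.1 hw).2)).le)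

theorem Good.trans {N : ℕ} {G : Fin (2 * N) → ℕ} {e : Conf N} {p : Fin N → ℕ} (h : Good G e p)
    {σ : Equiv.Perm (Fin (2 * N))} (hσ : ∀ u, G (σ u) = G u) : Good G (e.trans σ) p := by
  refine ⟨fun k => ?_, fun c => ?_⟩
  · simpa [hσ] using h.lt k
  · have : crossing G (e.trans σ) c = crossing G e c := by simp [crossing, hσ]
    rw [this, h.image_eq]

theorem SameCount.trans_perm {N : ℕ} {G : Fin (2 * N) → ℕ} {e f : Conf N} (h : SameCount G e f)
    {σ : Equiv.Perm (Fin (2 * N))} (hσ : ∀ u, G (σ u) = G u) : SameCount G (e.trans σ) f := by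
  intro c
  simpa [hσ] using h c

theorem Good.confCoef_trans {N d : ℕ} {s : ℕ → ℕ} {e : Conf N} {p : Fin N → ℕ}
    (h : Good (G N d s) e p) {σ : Equiv.Perm (Fin (2 * N))} (hσ : ∀ u, G N d s (σ u) = G N d s u) :
    confCoef d s (e.trans σ) p = (∏ k, ((p k : ℤ) + 1)) * (sgn e : ℤ) *
      (Equiv.Perm.sign σ * ∏ u, levelMatrix d s e p u (σ u)) := by
  have h1 : ∏ u, levelMatrix d s e p u (σ u) = ∏ k,
      ((descPochhammer ℤ (off d s (σ (e (k, false))))).eval (p k : ℤ) *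
        (descPochhammer ℤ (off d s (σ (e (k, true))))).eval (-(p k : ℤ) - 2)) := by
    rw [← e.prod_comp, Fintype.prod_prod_type]
    refine Finset.prod_congr rfl fun k _ => ?_
    simp [levelMatrix, hσ, mul_comm]
  rw [h1, mul_right_comm, mul_left_comm (∏ k, ((p k : ℤ) + 1)), ← Finset.prod_mul_distrib, confCoef,
    sgn_trans_perm, Units.val_mul]
  have h2 : ∀ k, linkCoef d s ((e.trans σ) (k, false) : ℕ) ((e.trans σ) (k, true) : ℕ) (p k) =
      ((p k : ℤ) + 1) * ((descPochhammer ℤ (off d s (σ (e (k, false))))).eval (p k : ℤ) *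
        (descPochhammer ℤ (off d s (σ (e (k, true))))).eval (-(p k : ℤ) - 2)) := fun k => by
    have h3 : grp d s (σ (e (k, false))) < grp d s (σ (e (k, true))) := by
      have := h.lt k
      rw [← hσ, ← hσ (e (k, true))] at this
      exact this
    simp only [linkCoef, Equiv.trans_apply, h3.ne, h3, if_true, if_false, coef]
  simp only [h2]
  ring

/-- The permutations preserving the groups. -/
noncomputable def groupPerms (N d : ℕ) (s : ℕ → ℕ) : Finset (Equiv.Perm (Fin (2 * N))) :=
  Finset.univ.filter fun σ => ∀ u, G N d s (σ u) = G N d s u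

theorem mem_groupPerms {N d : ℕ} {s : ℕ → ℕ} {σ : Equiv.Perm (Fin (2 * N))} :
    σ ∈ groupPerms N d s ↔ ∀ u, G N d s (σ u) = G N d s u := by
  simp [groupPerms]

theorem Good.sum_confCoef_pos {N d : ℕ} {s : ℕ → ℕ} (hsum : q s d = 2 * N) {e : Conf N}
    {p : Fin N → ℕ} (h : Good (G N d s) e p) :
    0 < ∑ σ ∈ groupPerms N d s, confCoef d s (e.trans σ) p := by
  rw [Finset.sum_congr rfl fun σ hσ => h.confCoef_trans (mem_groupPerms.1 hσ),
    ← Finset.mul_sum]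
  have h1 : ∑ σ ∈ groupPerms N d s,
      ((Equiv.Perm.sign σ : ℤ) * ∏ u, levelMatrix d s e p u (σ u)) = (levelMatrix d s e p).det := by
    rw [← Matrix.det_transpose, Matrix.det_apply']
    refine Finset.sum_subset (Finset.subset_univ _) fun σ _ hσ => ?_
    rw [mem_groupPerms, not_forall] at hσ
    obtain ⟨u, hu⟩ := hσ
    rw [Finset.prod_eq_zero (Finset.mem_univ u) (if_neg (Ne.symm hu)), mul_zero]
  rw [h1, mul_assoc]
  exact mul_pos (Finset.prod_pos fun k _ => by positivity) (h.sgn_mul_det_pos hsum)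

/-- The configurations of minimal degree contributing to the leading coefficient. -/
noncomputable def goods {N : ℕ} (G : Fin (2 * N) → ℕ) (f : Conf N) (P : Finset (Fin N → ℕ)) :
    Finset (Conf N × (Fin N → ℕ)) :=
  ((Finset.univ.filter fun e : Conf N => SameCount G e f) ×ˢ P).filter fun x => Good G x.1 x.2

theorem mem_goods {N : ℕ} {G : Fin (2 * N) → ℕ} {f : Conf N} {P : Finset (Fin N → ℕ)}
    {x : Conf N × (Fin N → ℕ)} :
    x ∈ goods G f P ↔ SameCount G x.1 f ∧ x.2 ∈ P ∧ Good G x.1 x.2 := by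
  simp [goods, and_assoc]

theorem sum_goods_trans {N d : ℕ} {s : ℕ → ℕ} (f : Conf N) (P : Finset (Fin N → ℕ))
    {σ : Equiv.Perm (Fin (2 * N))} (hσ : ∀ u, G N d s (σ u) = G N d s u) :
    ∑ x ∈ goods (G N d s) f P, confCoef d s (x.1.trans σ) x.2 =
      ∑ x ∈ goods (G N d s) f P, confCoef d s x.1 x.2 := by
  have hσ' : ∀ u, G N d s (σ.symm u) = G N d s u := fun u => by
    rw [← hσ (σ.symm u), Equiv.apply_symm_apply]
  refine Finset.sum_nbij' (fun x => (x.1.trans σ, x.2)) (fun x => (x.1.trans σ.symm, x.2))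
    (fun x hx => ?_) (fun x hx => ?_) (fun x _ => ?_) (fun x _ => ?_) fun x _ => rfl
  · rw [mem_goods] at hx ⊢
    exact ⟨hx.1.trans_perm hσ, hx.2.1, hx.2.2.trans hσ⟩
  · rw [mem_goods] at hx ⊢
    exact ⟨hx.1.trans_perm hσ', hx.2.1, hx.2.2.trans hσ'⟩
  · ext <;> simp
  · ext <;> simp

theorem sum_goods_pos {N d : ℕ} {s : ℕ → ℕ} (hsum : q s d = 2 * N) {f : Conf N}
    {P : Finset (Fin N → ℕ)} (hne : (goods (G N d s) f P).Nonempty) :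
    0 < ∑ x ∈ goods (G N d s) f P, confCoef d s x.1 x.2 := by
  have h1 : 0 < ∑ x ∈ goods (G N d s) f P,
      ∑ σ ∈ groupPerms N d s, confCoef d s (x.1.trans σ) x.2 :=
    Finset.sum_pos (fun x hx => (mem_goods.1 hx).2.2.sum_confCoef_pos hsum) hne
  rw [Finset.sum_comm, Finset.sum_congr rfl fun σ hσ =>
    sum_goods_trans f P (mem_groupPerms.1 hσ), Finset.sum_const, nsmul_eq_mul] at h1
  exact pos_of_mul_pos_right h1 (Nat.cast_nonneg _)

/-- The number of links of a pattern enclosing a given one. -/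
noncomputable def depth {N : ℕ} (α : (Fin N → Fin (2 * N)) × (Fin N → Fin (2 * N))) (k : Fin N) :
    ℕ := (Finset.univ.filter fun l => α.1 l < α.1 k ∧ α.2 k < α.2 l).card

theorem good_confOf {N d : ℕ} {s : ℕ → ℕ} {α : (Fin N → Fin (2 * N)) × (Fin N → Fin (2 * N))}
    (h : valenced N d s α) : Good (G N d s) (confOf h.1) (depth α) := by
  have hG := G_mono N d s
  have hnc := h.1.2.2.2
  refine ⟨fun k => by simpa using valenced_lt h k, fun c => ?_⟩
  have hmem : ∀ k, k ∈ crossing (G N d s) (confOf h.1) c ↔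
      G N d s (α.1 k) ≤ c ∧ c < G N d s (α.2 k) := fun k => by simp [mem_crossing]
  have hnest : ∀ k ∈ crossing (G N d s) (confOf h.1) c,
      ∀ l ∈ crossing (G N d s) (confOf h.1) c, k < l → α.1 k < α.1 l ∧ α.2 l < α.2 k := by
    intro k hk l hl hkl
    rw [hmem] at hk hl
    have h1 := h.1.1 k l hkl
    have h2 : α.1 l < α.2 k := hG.reflect_lt (hl.1.trans_lt hk.2)
    refine ⟨h1, lt_of_le_of_ne (not_lt.1 fun h3 => hnc k l ⟨h1, h2, h3⟩) fun h3 => hkl.ne ?_⟩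
    have := (confOf h.1).injective (a₁ := (l, true)) (a₂ := (k, true)) (by simpa using h3)
    exact (congrArg Prod.fst this).symm
  have hlt : ∀ k ∈ crossing (G N d s) (confOf h.1) c,
      depth α k < (crossing (G N d s) (confOf h.1) c).card := by
    intro k hk
    refine Finset.card_lt_card ⟨fun l hl => ?_, fun hsub => ?_⟩
    · simp only [Finset.mem_filter, Finset.mem_univ, true_and] at hl
      rw [hmem] at hk ⊢
      exact ⟨(hG hl.1.le).trans hk.1, hk.2.trans_le (hG hl.2.le)⟩
    · simpa using hsub hk
  have hmono : ∀ k ∈ crossing (G N d s) (confOf h.1) c,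
      ∀ l ∈ crossing (G N d s) (confOf h.1) c, k < l → depth α k < depth α l := by
    intro k hk l hl hkl
    have h1 := hnest k hk l hl hkl
    refine Finset.card_lt_card ⟨fun m hm => ?_, fun hsub => ?_⟩
    · simp only [Finset.mem_filter, Finset.mem_univ, true_and] at hm ⊢
      exact ⟨hm.1.trans h1.1, h1.2.trans hm.2⟩
    · have h2 : k ∈ Finset.univ.filter fun m => α.1 m < α.1 k ∧ α.2 k < α.2 m :=
        hsub (by simpa using h1)
      simp at h2
  refine Finset.eq_of_subset_of_card_le (fun x hx => ?_) ?_
  · obtain ⟨k, hk, rfl⟩ := Finset.mem_image.1 hx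
    exact Finset.mem_range.2 (hlt k hk)
  · rw [Finset.card_range, Finset.card_image_of_injOn]
    intro k hk l hl hkl
    rcases lt_trichotomy k l with h1 | h1 | h1
    · exact absurd hkl (hmono k hk l hl h1).ne
    · exact h1
    · exact absurd hkl (hmono l hl k hk h1).ne'

theorem goods_nonempty {N d D : ℕ} {s : ℕ → ℕ}
    {α : (Fin N → Fin (2 * N)) × (Fin N → Fin (2 * N))} (h : valenced N d s α) (hD : N ≤ D) :
    (goods (G N d s) (confOf h.1) (Fintype.piFinset fun _ => Finset.range D)).Nonempty :=
  ⟨(confOf h.1, depth α), mem_goods.2 ⟨fun _ => rfl, Fintype.mem_piFinset.2 fun k =>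
    Finset.mem_range.2 (((good_confOf h).level_lt k).trans_le hD), good_confOf h⟩⟩

theorem confCoef_eq_zero {N d : ℕ} {s : ℕ → ℕ} {e : Conf N} (p : Fin N → ℕ) {k : Fin N}
    (hk : G N d s (e (k, false)) = G N d s (e (k, true))) : confCoef d s e p = 0 := by
  unfold confCoef
  have h : linkCoef d s (e (k, false) : ℕ) (e (k, true) : ℕ) (p k) = 0 := if_pos hk
  rw [Finset.prod_eq_zero (Finset.mem_univ k) h, mul_zero]

open Asymptotics Filter Topology in
/-- The leading asymptotics of `U_α` along the curve `x_j = t ^ (-q g j)` as `t → 0`. -/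
theorem exists_tendsto_U {N d : ℕ} {s g : ℕ → ℕ} (hsum : q s d = 2 * N) (hg : ∀ c, 0 < g c)
    {α : (Fin N → Fin (2 * N)) × (Fin N → Fin (2 * N))} (hα : valenced N d s α) :
    ∃ C : ℝ, 0 < C ∧ Tendsto (fun t : ℝ =>
      (N.factorial : ℝ) * Real.pi ^ N / t ^ (∑ u : Fin (2 * N), wt d s (q g) u) *
        U N d s α (fun j => (t ^ q g j)⁻¹) / t ^ minDeg d g (G N d s) (confOf hα.1))
      (𝓝[>] 0) (𝓝 C) := by
  set m := minDeg d g (G N d s) (confOf hα.1) with hm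
  set P := Fintype.piFinset fun _ : Fin N => Finset.range (m + 1 + N) with hP
  set S := ((Finset.univ.filter fun e : Conf N => SameCount (G N d s) e (confOf hα.1)) ×ˢ P).filter
    fun x => ¬Collides (G N d s) x.1 x.2 with hS
  have hf : ∀ k, G N d s (confOf hα.1 (k, false)) < G N d s (confOf hα.1 (k, true)) := fun k => by
    simpa using valenced_lt hα k
  have hmem : ∀ x ∈ S, SameCount (G N d s) x.1 (confOf hα.1) ∧ x.2 ∈ P ∧
      ¬Collides (G N d s) x.1 x.2 := fun x hx => by
    simpa [hS, and_assoc] using hx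
  have hle : ∀ x ∈ S, m ≤ deg (q g) (G N d s) x.1 x.2 := fun x hx =>
    minDeg_le_deg g (G_lt hsum) (hmem x hx).1 hf (hmem x hx).2.2
  have hC : ∑ x ∈ S, (confCoef d s x.1 x.2 : ℝ) * 0 ^ (deg (q g) (G N d s) x.1 x.2 - m) =
      ((∑ x ∈ goods (G N d s) (confOf hα.1) P, confCoef d s x.1 x.2 : ℤ) : ℝ) := by
    have hsub : goods (G N d s) (confOf hα.1) P ⊆ S := fun x hx => by
      rw [mem_goods] at hx
      simpa [hS, and_assoc] using ⟨hx.1, hx.2.1, hx.2.2.not_collides⟩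
    rw [← Finset.sum_subset hsub fun x hx hx' => ?_, Int.cast_sum]
    · refine Finset.sum_congr rfl fun x hx => ?_
      rw [mem_goods] at hx
      rw [hx.2.2.deg_eq_minDeg g (G_lt hsum) hx.1 hf, ← hm, Nat.sub_self, pow_zero, mul_one]
    · have h1 := hmem x hx
      by_cases hd : deg (q g) (G N d s) x.1 x.2 = m
      · by_cases hne : ∀ k, G N d s (x.1 (k, false)) ≠ G N d s (x.1 (k, true))
        · exact absurd (mem_goods.2 ⟨h1.1, h1.2.1,
            good_of_deg_eq hg (G_lt hsum) h1.1 hf h1.2.2 hne hd⟩) hx'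
        · push Not at hne
          obtain ⟨k, hk⟩ := hne
          rw [confCoef_eq_zero x.2 hk, Int.cast_zero, zero_mul]
      · have := hle x hx
        rw [zero_pow (by omega), mul_zero]
  refine ⟨_, Int.cast_pos.2 (sum_goods_pos hsum (goods_nonempty hα (D := m + 1 + N) (by omega))), ?_⟩
  rw [← hP, ← hC]
  have hO := U_isBigO hsum (strictMono_q hg) (m + 1 + N) hα
  simp only [← hP, sum_filter_not_collides (strictMono_q hg), ← hS] at hO
  have hlo : (fun t : ℝ => t ^ (m + 1 + N)) =o[𝓝[>] 0] fun t => t ^ m :=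
    (isLittleO_pow_pow (by omega)).mono nhdsWithin_le_nhds
  have h1 := (hO.trans_isLittleO hlo).tendsto_div_nhds_zero
  have h2 : Tendsto (fun t : ℝ => ∑ x ∈ S, (confCoef d s x.1 x.2 : ℝ) *
      t ^ (deg (q g) (G N d s) x.1 x.2 - m)) (𝓝[>] 0)
      (𝓝 (∑ x ∈ S, (confCoef d s x.1 x.2 : ℝ) * 0 ^ (deg (q g) (G N d s) x.1 x.2 - m))) :=
    ((continuous_finsetSum _ fun x _ => continuous_const.mul (continuous_pow _)).tendsto 0).mono_left
      nhdsWithin_le_nhds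
  have h3 := h1.add h2
  rw [zero_add] at h3
  refine h3.congr' ?_
  filter_upwards [self_mem_nhdsWithin] with t ht
  have ht0 : (t : ℝ) ≠ 0 := (Set.mem_Ioi.1 ht).ne'
  have h4 : ∑ x ∈ S, (confCoef d s x.1 x.2 : ℝ) * t ^ deg (q g) (G N d s) x.1 x.2 =
      (∑ x ∈ S, (confCoef d s x.1 x.2 : ℝ) * t ^ (deg (q g) (G N d s) x.1 x.2 - m)) * t ^ m := by
    rw [Finset.sum_mul]
    refine Finset.sum_congr rfl fun x hx => ?_
    rw [mul_assoc, ← pow_add, Nat.sub_add_cancel (hle x hx)]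
  rw [h4, sub_div, mul_div_cancel_right₀ _ (pow_ne_zero _ ht0), sub_add_cancel]

theorem digits_unique {B : ℕ} {d : ℕ} : ∀ {a b : ℕ → ℕ}, (∀ c, a c < B) → (∀ c, b c < B) →
    ∑ c ∈ Finset.range d, B ^ c * a c = ∑ c ∈ Finset.range d, B ^ c * b c →
    ∀ c < d, a c = b c := by
  induction d with
  | zero => intro a b _ _ _ c hc; omega
  | succ d ih =>
    intro a b ha hb h
    have key : ∀ a : ℕ → ℕ, ∑ c ∈ Finset.range (d + 1), B ^ c * a c =
        a 0 + B * ∑ c ∈ Finset.range d, B ^ c * a (c + 1) := fun a => by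
      rw [Finset.sum_range_succ', Finset.mul_sum, pow_zero, one_mul, add_comm]
      simp only [pow_succ', mul_assoc]
    rw [key, key] at h
    have h0 : a 0 = b 0 := by
      have := congrArg (· % B) h
      simpa [Nat.add_mul_mod_self_left, Nat.mod_eq_of_lt (ha 0), Nat.mod_eq_of_lt (hb 0)] using this
    rw [h0, add_right_inj] at h
    have h1 := ih (fun c => ha (c + 1)) (fun c => hb (c + 1))
      (Nat.eq_of_mul_eq_mul_left ((Nat.zero_le _).trans_lt (ha 0)) h)
    rintro (_ | c) hc
    · exact h0
    · exact h1 c (by omega)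

theorem strictMono_sum_range_add_one : StrictMono fun h => ∑ i ∈ Finset.range h, (i + 1) :=
  strictMono_nat_of_lt_succ fun n => by
    rw [Finset.sum_range_succ]
    omega

theorem mem_range_iff_card_lt {ι : Type*} [Fintype ι] {n : ℕ} (γ : ι → Fin n) (u : Fin n) :
    u ∈ Set.range γ ↔ (Finset.univ.filter fun k => (γ k : ℕ) < u).card <
      (Finset.univ.filter fun k => (γ k : ℕ) < u + 1).card := by
  constructor
  · rintro ⟨k, rfl⟩
    refine Finset.card_lt_card ⟨fun l hl => ?_, fun hsub => ?_⟩
    · simp only [Finset.mem_filter, Finset.mem_univ, true_and] at hl ⊢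
      omega
    · have : k ∈ Finset.univ.filter fun l => (γ l : ℕ) < γ k := hsub (by simp)
      simp at this
  · intro h
    by_contra hu
    refine h.ne (congrArg _ (Finset.filter_congr fun k _ => ?_))
    have : (γ k : ℕ) ≠ u := fun h' => hu ⟨k, Fin.ext h'⟩
    omega

theorem eq_of_path_eq {N : ℕ} {α β : (Fin N → Fin (2 * N)) × (Fin N → Fin (2 * N))}
    (hα : isLP N α) (hβ : isLP N β) (h : ∀ t ≤ 2 * N, path N α t = path N β t) : α = β := by
  have hcard : ∀ t ≤ 2 * N, (Finset.univ.filter fun k => (α.1 k : ℕ) < t).card =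
      (Finset.univ.filter fun k => (β.1 k : ℕ) < t).card := fun t ht => by
    have h1 := path_eq hα ht
    have h2 := path_eq hβ ht
    have h3 := h t ht
    have h4 : path N α t = _ - _ := rfl
    have h5 : path N β t = _ - _ := rfl
    omega
  refine isLP_unique hα hβ (Set.ext fun u => ?_)
  rw [mem_range_iff_card_lt, mem_range_iff_card_lt, hcard _ u.2.le, hcard _ u.2]

theorem eq_of_minDeg_eq {N d B : ℕ} {s : ℕ → ℕ} (hsum : q s d = 2 * N)
    (hB : ∑ i ∈ Finset.range N, (i + 1) < B)
    {α β : (Fin N → Fin (2 * N)) × (Fin N → Fin (2 * N))} (hα : valenced N d s α)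
    (hβ : valenced N d s β) (h : minDeg d (B ^ ·) (G N d s) (confOf hα.1) =
      minDeg d (B ^ ·) (G N d s) (confOf hβ.1)) : α = β := by
  have hlt : ∀ (f : Conf N) c,
      ∑ i ∈ Finset.range (crossing (G N d s) f c).card, (i + 1) < B := fun f c =>
    (sum_range_add_one_mono ((Finset.card_le_univ _).trans_eq (Fintype.card_fin N))).trans_lt hB
  have hcard : ∀ c < d, (crossing (G N d s) (confOf hα.1) c).card =
      (crossing (G N d s) (confOf hβ.1) c).card := fun c hc =>
    strictMono_sum_range_add_one.injective (digits_unique (hlt _) (hlt _) h c hc)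
  have key : SameCount (G N d s) (confOf hα.1) (confOf hβ.1) := by
    refine sameCount_of_card_lt hsum fun j hj => ?_
    rcases j with _ | c
    · simp
    · have h1 := card_crossing_add (G N d s) (confOf hα.1) c
      have h2 := card_crossing_add (G N d s) (confOf hβ.1) c
      have h3 := card_filter_add_card_filter (confOf hα.1) fun u => G N d s u ≤ c
      have h4 := card_filter_add_card_filter (confOf hβ.1) fun u => G N d s u ≤ c
      rw [revCrossing_eq_empty (fun k => by simpa using valenced_lt hα k), Finset.card_empty] at h1
      rw [revCrossing_eq_empty (fun k => by simpa using valenced_lt hβ k), Finset.card_empty] at h2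
      have h5 := hcard c hj
      simp only [Nat.lt_succ_iff]
      omega
  have hαβ := (geqVal_iff hsum hα.1 hβ).2 key
  have hβα := (geqVal_iff hsum hβ.1 hα).2 key.symm
  exact eq_of_path_eq hα.1 hβ.1 fun t ht => le_antisymm (hβα.1 t ht) (hαβ.1 t ht)

theorem chamber_curve {g : ℕ → ℕ} (hg : ∀ c, 0 < g c) (d : ℕ) {t : ℝ} (h0 : 0 < t) (h1 : t < 1) :
    chamber d fun j => (t ^ q g j)⁻¹ := fun _ _ hij _ =>
  (inv_lt_inv₀ (pow_pos h0 _) (pow_pos h0 _)).2 (pow_lt_pow_right_of_lt_one₀ h0 h1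
    (strictMono_q hg hij))

open Filter Topology in
theorem coeff_eq_zero {N d : ℕ} {s : ℕ → ℕ} (hsum : q s d = 2 * N)
    {c : (Fin N → Fin (2 * N)) × (Fin N → Fin (2 * N)) → ℝ}
    (hc : ∀ x : ℕ → ℝ, chamber d x →
      ∑ α ∈ (LP N).filter (valenced N d s), c α * U N d s α x = 0) :
    ∀ α ∈ (LP N).filter (valenced N d s), c α = 0 := by
  set B := ∑ i ∈ Finset.range N, (i + 1) + 1
  have hB : ∑ i ∈ Finset.range N, (i + 1) < B := Nat.lt_succ_self _
  have hg : ∀ c, 0 < B ^ c := fun c => pow_pos (Nat.succ_pos _) c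
  by_contra! hne
  obtain ⟨γ, hγ, hcγ⟩ := hne
  let m : (Fin N → Fin (2 * N)) × (Fin N → Fin (2 * N)) → ℕ := fun α =>
    if h : isLP N α then minDeg d (B ^ ·) (G N d s) (confOf h) else 0
  have hm : ∀ {α} (h : isLP N α), m α = minDeg d (B ^ ·) (G N d s) (confOf h) := fun h => dif_pos h
  obtain ⟨α₀, hα₀, hmin⟩ := Finset.exists_min_image
    (((LP N).filter (valenced N d s)).filter fun α => c α ≠ 0) m
    ⟨γ, Finset.mem_filter.2 ⟨hγ, hcγ⟩⟩
  rw [Finset.mem_filter, Finset.mem_filter] at hα₀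
  obtain ⟨⟨-, hv₀⟩, hc₀⟩ := hα₀
  choose! C hC0 hC using fun α (h : valenced N d s α) =>
    exists_tendsto_U (g := (B ^ ·)) hsum hg h
  let F : (Fin N → Fin (2 * N)) × (Fin N → Fin (2 * N)) → ℝ → ℝ := fun α t =>
    (N.factorial : ℝ) * Real.pi ^ N / t ^ (∑ u : Fin (2 * N), wt d s (q (B ^ ·)) u) *
      U N d s α (fun j => (t ^ q (B ^ ·) j)⁻¹)
  have hlim : ∀ α ∈ (LP N).filter (valenced N d s),
      Tendsto (fun t => c α * (F α t / t ^ m α₀)) (𝓝[>] 0)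
        (𝓝 (if α = α₀ then c α₀ * C α₀ else 0)) := by
    intro α hα
    have hv := (Finset.mem_filter.1 hα).2
    split_ifs with h
    · subst h
      rw [hm hv.1]
      exact (hC α hv).const_mul _
    · by_cases hcα : c α = 0
      · simp [hcα]
      · have h1 := hmin α (Finset.mem_filter.2 ⟨hα, hcα⟩)
        have h2 : m α ≠ m α₀ := fun h3 => h (eq_of_minDeg_eq hsum hB hv hv₀ (by
          rw [← hm, ← hm, h3]))
        have h3 : Tendsto (fun t : ℝ => t ^ (m α - m α₀)) (𝓝[>] 0) (𝓝 0) := by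
          have := ((continuous_pow (m α - m α₀)).tendsto (0 : ℝ)).mono_left
            (nhdsWithin_le_nhds (s := Set.Ioi 0))
          rwa [zero_pow (by omega)] at this
        have h4 := ((hC α hv).mul h3).const_mul (c α)
        rw [mul_zero, mul_zero] at h4
        refine h4.congr' ?_
        filter_upwards [self_mem_nhdsWithin] with t ht
        have ht0 : (t : ℝ) ≠ 0 := (Set.mem_Ioi.1 ht).ne'
        have h5 : t ^ m α = t ^ (m α - m α₀) * t ^ m α₀ := by
          rw [← pow_add, Nat.sub_add_cancel h1]
        rw [← hm, h5, mul_comm (t ^ (m α - m α₀)) (t ^ m α₀), div_mul_eq_div_div,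
          div_mul_cancel₀ _ (pow_ne_zero _ ht0)]
  have hsumlim := tendsto_finsetSum _ hlim
  rw [Finset.sum_ite_eq', if_pos (by simpa [LP] using ⟨hv₀.1, hv₀⟩)] at hsumlim
  have hzero : (fun t => ∑ α ∈ (LP N).filter (valenced N d s), c α * (F α t / t ^ m α₀))
      =ᶠ[𝓝[>] 0] fun _ => 0 := by
    filter_upwards [Ioo_mem_nhdsGT (zero_lt_one' ℝ)] with t ht
    have h1 := hc _ (chamber_curve hg d ht.1 ht.2)
    have h2 : ∀ α, c α * (F α t / t ^ m α₀) =
        (N.factorial : ℝ) * Real.pi ^ N / t ^ (∑ u : Fin (2 * N), wt d s (q (B ^ ·)) u) / t ^ m α₀ *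
          (c α * U N d s α (fun j => (t ^ q (B ^ ·) j)⁻¹)) := fun α => by
      simp only [F]
      ring
    simp only [h2]
    rw [← Finset.mul_sum, h1, mul_zero]
  have h0 := tendsto_nhds_unique (hsumlim.congr' hzero) tendsto_const_nhds
  exact (mul_ne_zero hc₀ (hC0 α₀ hv₀).ne') h0

end UST

/-- Property (LIN) of Theorem D.2 of the paper: the explicit basis functions
`{U_α : α a ς-valenced link pattern}` are linearly independent over `ℝ` as functions on the
chamber `𝔛_d`: any vanishing linear combination has all coefficients zero. -/
theorem stmt16 (N d : ℕ) (hN : 0 < N) (hd : 0 < d) (s : ℕ → ℕ)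
    (hs : ∀ i, i < d → 0 < s i) (hsum : UST.q s d = 2 * N) :
    ∀ c : ((Fin N → Fin (2 * N)) × (Fin N → Fin (2 * N))) → ℝ,
      (∀ x : ℕ → ℝ, UST.chamber d x →
        ∑ α ∈ (UST.LP N).filter (UST.valenced N d s), c α * UST.U N d s α x = 0) →
      ∀ α ∈ (UST.LP N).filter (UST.valenced N d s), c α = 0 := by
  exact fun c hc => UST.coeff_eq_zero hsum hc
end

section
/- Fix N ≥ 1 and valences ς = (s_1, …, s_d) of positive integers with s_1 + ⋯ + s_d = 2N, set q_0 = 0, q_j = s_1 + ⋯ + s_j, and groups J_j = {q_{j−1}+1, …, q_j}. Let F be any finite real-linear combination of the functions Δ_β, β ∈ LP_N, where Δ_β(x_1, …, x_{2N}) = det( 1/(π (x_{a_k} − x_{b_ℓ})²) )_{k,ℓ=1}^{N} is defined for x with pairwise distinct coordinates. Define the antisymmetrized function (p_ς F)(x) = (1/(s_1! ⋯ s_d!)) Σ_σ sgn(σ) F(x_{σ(1)}, …, x_{σ(2N)}), where σ ranges over all permutations of {1, …, 2N} that map each group J_j to itself. Then there exists a continuous function g on the open set U = {x ∈ ℝ^{2N}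 : x_a ≠ x_b whenever a and b lie in different groups} such that for every x ∈ U with pairwise distinct coordinates, (p_ς F)(x) = ( ∏_{k=1}^{d} ∏_{q_{k−1} < i < j ≤ q_k} (x_j − x_i) ) · g(x). -/
open scoped BigOperators Classical

namespace UST17

/-- Partial sums of the valences: `q j = s_1 + ⋯ + s_j`. -/
def q (s : ℕ → ℕ) (j : ℕ) : ℕ := ∑ i ∈ Finset.range j, s i

/-- The group (0-based) of the 0-based position `t`. -/
def grp (d : ℕ) (s : ℕ → ℕ) (t : ℕ) : ℕ :=
  ((Finset.range d).filter (fun j => q s (j + 1) ≤ t)).card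

/-- A (labeled) `N`-link pattern in left-to-right orientation. -/
def isLP (N : ℕ) (β : (Fin N → Fin (2 * N)) × (Fin N → Fin (2 * N))) : Prop :=
  (∀ k l : Fin N, k < l → β.1 k < β.1 l) ∧
    (∀ k, β.1 k < β.2 k) ∧
    Function.Bijective (Sum.elim β.1 β.2) ∧
    ∀ k l, ¬(β.1 k < β.1 l ∧ β.1 l < β.2 k ∧ β.2 k < β.2 l)

/-- The set of `N`-link patterns. -/
noncomputable def LP (N : ℕ) : Finset ((Fin N → Fin (2 * N)) × (Fin N → Fin (2 * N))) :=
  Finset.univ.filter (isLP N)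

/-- The Fomin determinant `Δ_β` with the unfused Brownian excursion kernel
`1/(π (u − v)²)`. -/
noncomputable def Δ (N : ℕ) (x : Fin (2 * N) → ℝ)
    (β : (Fin N → Fin (2 * N)) × (Fin N → Fin (2 * N))) : ℝ :=
  Matrix.det (Matrix.of fun k ℓ : Fin N =>
    1 / (Real.pi * (x (β.1 k) - x (β.2 ℓ)) ^ 2))

end UST17

namespace MvPolynomial

variable {ι R : Type*} [CommRing R]

/-- Substituting `X i` for `X j` does not change a polynomial modulo `X j - X i`. -/
theorem X_sub_X_dvd_sub_aeval_update (i j : ι) (p : MvPolynomial ι R) :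
    (X j - X i : MvPolynomial ι R) ∣ p - aeval (Function.update X j (X i)) p := by
  rw [← Ideal.mem_span_singleton, ← Ideal.Quotient.mk_eq_mk_iff_sub_mem]
  have h : Ideal.Quotient.mkₐ R (Ideal.span {(X j - X i : MvPolynomial ι R)}) =
      (Ideal.Quotient.mkₐ R (Ideal.span {(X j - X i : MvPolynomial ι R)})).comp
        (aeval (Function.update X j (X i))) := by
    refine MvPolynomial.algHom_ext fun k => ?_
    obtain rfl | hk := eq_or_ne k j
    · simp only [AlgHom.comp_apply, aeval_X, Function.update_self, Ideal.Quotient.mkₐ_eq_mk]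
      rw [Ideal.Quotient.mk_eq_mk_iff_sub_mem]
      exact Ideal.mem_span_singleton_self _
    · simp [hk]
  exact DFunLike.congr_fun h p

theorem X_sub_X_dvd_iff (i j : ι) (p : MvPolynomial ι R) :
    (X j - X i : MvPolynomial ι R) ∣ p ↔
      aeval (Function.update X j (X i : MvPolynomial ι R)) p = 0 := by
  constructor
  · rintro ⟨r, rfl⟩
    obtain rfl | hij := eq_or_ne i j <;> simp_all
  · intro h
    have hdvd := X_sub_X_dvd_sub_aeval_update i j p
    rwa [h, sub_zero] at hdvd

theorem eval_aeval_update (i j : ι) (x : ι → R) (p : MvPolynomial ι R) :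
    eval x (aeval (Function.update X j (X i : MvPolynomial ι R)) p) =
      eval (Function.update x j (x i)) p := by
  rw [← coe_aeval_eq_eval, ← coe_aeval_eq_eval]
  simp only [RingHom.coe_coe, ← AlgHom.comp_apply]
  congr 1
  refine MvPolynomial.algHom_ext fun k => ?_
  by_cases hk : k = j <;> simp [hk]

theorem prime_X_sub_X [IsDomain R] {i j : ι} (hij : i ≠ j) :
    Prime (X j - X i : MvPolynomial ι R) := by
  have h0 : (X j - X i : MvPolynomial ι R) ≠ 0 := by
    rw [sub_ne_zero]
    exact fun h => hij (X_injective h).symm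
  rw [← Ideal.span_singleton_prime h0]
  have h : Ideal.span {(X j - X i : MvPolynomial ι R)} =
      RingHom.ker (aeval (R := R) (Function.update X j (X i : MvPolynomial ι R))) := by
    ext p
    rw [Ideal.mem_span_singleton, X_sub_X_dvd_iff, RingHom.mem_ker]
  rw [h]
  exact RingHom.ker_isPrime _

/-- Differences of variables attached to distinct increasing pairs are relatively prime. -/
theorem isRelPrime_X_sub_X [IsDomain R] [LinearOrder ι] {i j k l : ι} (hij : i < j)
    (hkl : k < l) (h : i ≠ k ∨ j ≠ l) :
    IsRelPrime (X j - X i : MvPolynomial ι R) (X l - X k) := by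
  rw [(prime_X_sub_X hij.ne).irreducible.isRelPrime_iff_not_dvd, X_sub_X_dvd_iff, map_sub,
    aeval_X, aeval_X, sub_eq_zero]
  intro he
  simp only [Function.update_apply] at he
  split_ifs at he with h₁ h₂ h₂
  · exact hkl.ne (h₂.trans h₁.symm)
  · have := X_injective he
    grind
  · have := X_injective he
    grind
  · exact hkl.ne (X_injective he).symm

end MvPolynomial

namespace UST17

variable {n : ℕ}

/-- The permutations that preserve each fibre of the labelling `G`. -/
def fiberPerms (G : Fin n → ℕ) : Finset (Equiv.Perm (Fin n)) :=
  Finset.univ.filter fun σ => ∀ t, G (σ t) = G t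

theorem mem_fiberPerms {G : Fin n → ℕ} {σ : Equiv.Perm (Fin n)} :
    σ ∈ fiberPerms G ↔ ∀ t, G (σ t) = G t := by
  simp [fiberPerms]

theorem mul_swap_mem_fiberPerms {G : Fin n → ℕ} {σ : Equiv.Perm (Fin n)}
    (hσ : σ ∈ fiberPerms G) {i j : Fin n} (h : G i = G j) :
    σ * Equiv.swap i j ∈ fiberPerms G := by
  rw [mem_fiberPerms] at hσ ⊢
  intro t
  rw [Equiv.Perm.mul_apply, hσ, Equiv.swap_apply_def]
  split_ifs <;> simp_all

theorem swap_mul_mem_fiberPerms {G : Fin n → ℕ} {σ : Equiv.Perm (Fin n)}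
    (hσ : σ ∈ fiberPerms G) {i j : Fin n} (h : G i = G j) :
    Equiv.swap i j * σ ∈ fiberPerms G := by
  rw [mem_fiberPerms] at hσ ⊢
  intro t
  rw [← hσ t, Equiv.Perm.mul_apply, Equiv.swap_apply_def]
  split_ifs <;> simp_all

/-- The signed sum of a function over the fibre-preserving permutations of its variables. -/
noncomputable def alternate (G : Fin n → ℕ) (f : (Fin n → ℝ) → ℝ) (x : Fin n → ℝ) : ℝ :=
  ∑ σ ∈ fiberPerms G, ((Equiv.Perm.sign σ : ℤ) : ℝ) * f (x ∘ σ)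

/-- A function invariant under a transposition within a fibre has zero signed sum. -/
theorem alternate_eq_zero {G : Fin n → ℕ} {f : (Fin n → ℝ) → ℝ} {i j : Fin n} (hij : i ≠ j)
    (hG : G i = G j) (hf : ∀ x, f (x ∘ Equiv.swap i j) = f x) (x : Fin n → ℝ) :
    alternate G f x = 0 := by
  refine Finset.sum_involution (fun σ _ => σ * Equiv.swap i j) ?_ ?_ ?_ ?_
  · intro σ _
    rw [Equiv.Perm.coe_mul, ← Function.comp_assoc, hf, Equiv.Perm.sign_mul,
      Equiv.Perm.sign_swap hij]
    simp
  · intro σ _ _ h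
    exact hij (Equiv.swap_eq_one_iff.mp (mul_eq_left.mp h))
  · intro σ hσ
    exact mul_swap_mem_fiberPerms hσ hG
  · intro σ _
    simp [mul_assoc]

/-- The signed sum vanishes at a point fixed by a transposition within a fibre. -/
theorem alternate_apply_eq_zero {G : Fin n → ℕ} {i j : Fin n} (hij : i ≠ j) (hG : G i = G j)
    (f : (Fin n → ℝ) → ℝ) {x : Fin n → ℝ} (hx : x ∘ Equiv.swap i j = x) :
    alternate G f x = 0 := by
  refine Finset.sum_involution (fun σ _ => Equiv.swap i j * σ) ?_ ?_ ?_ ?_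
  · intro σ _
    rw [Equiv.Perm.coe_mul, ← Function.comp_assoc, hx, Equiv.Perm.sign_mul,
      Equiv.Perm.sign_swap hij]
    simp
  · intro σ _ _ h
    exact hij (Equiv.swap_eq_one_iff.mp (mul_eq_right.mp h))
  · intro σ hσ
    exact swap_mul_mem_fiberPerms hσ hG
  · intro σ _
    simp [← mul_assoc]

/-- The product of the Vandermonde factors of the fibres. -/
noncomputable def vandermonde (G : Fin n → ℕ) : MvPolynomial (Fin n) ℝ :=
  ∏ i : Fin n, ∏ j ∈ Finset.univ.filter (fun j : Fin n => i < j ∧ G j = G i),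
    (MvPolynomial.X j - MvPolynomial.X i)

/-- The signed sum of a polynomial over the fibre-preserving permutations of its variables. -/
noncomputable def alternatePoly (G : Fin n → ℕ) (p : MvPolynomial (Fin n) ℝ) :
    MvPolynomial (Fin n) ℝ :=
  ∑ σ ∈ fiberPerms G, MvPolynomial.C ((Equiv.Perm.sign σ : ℤ) : ℝ) * MvPolynomial.rename σ p

theorem eval_alternatePoly (G : Fin n → ℕ) (p : MvPolynomial (Fin n) ℝ) (x : Fin n → ℝ) :
    MvPolynomial.eval x (alternatePoly G p) =
      alternate G (fun y => MvPolynomial.eval y p) x := by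
  simp [alternatePoly, alternate, MvPolynomial.eval_rename]

theorem X_sub_X_dvd_alternatePoly {G : Fin n → ℕ} {i j : Fin n} (hij : i ≠ j) (hG : G i = G j)
    (p : MvPolynomial (Fin n) ℝ) :
    (MvPolynomial.X j - MvPolynomial.X i : MvPolynomial (Fin n) ℝ) ∣ alternatePoly G p := by
  rw [MvPolynomial.X_sub_X_dvd_iff]
  refine MvPolynomial.funext fun x => ?_
  rw [MvPolynomial.eval_aeval_update, eval_alternatePoly, map_zero]
  refine alternate_apply_eq_zero hij hG _ ?_
  funext k
  simp only [Function.comp_apply, Function.update_apply, Equiv.swap_apply_def]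
  grind

theorem vandermonde_dvd_alternatePoly (G : Fin n → ℕ) (p : MvPolynomial (Fin n) ℝ) :
    vandermonde G ∣ alternatePoly G p := by
  rw [vandermonde, Finset.prod_sigma']
  refine Finset.prod_dvd_of_isRelPrime ?_ ?_
  · rintro ⟨i, j⟩ hij ⟨k, l⟩ hkl hne
    simp only [Finset.coe_sigma, Finset.coe_univ, Set.mem_sigma_iff, Finset.coe_filter,
      Set.mem_ofPred_eq, Finset.mem_univ, true_and, Set.mem_univ] at hij hkl
    refine MvPolynomial.isRelPrime_X_sub_X hij.1 hkl.1 ?_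
    by_contra! h
    obtain ⟨rfl, rfl⟩ : i = k ∧ j = l := h
    exact hne rfl
  · rintro ⟨i, j⟩ hij
    simp only [Finset.mem_sigma, Finset.mem_univ, Finset.mem_filter, true_and] at hij
    exact X_sub_X_dvd_alternatePoly hij.1.ne hij.2.symm p

/-- The points whose coordinates in different fibres are distinct. -/
def separated (G : Fin n → ℕ) : Set (Fin n → ℝ) :=
  {x | ∀ a b, G a ≠ G b → x a ≠ x b}

/-- The product of all differences of variables in different fibres. -/
noncomputable def crossDiff (G : Fin n → ℕ) : MvPolynomial (Fin n) ℝ :=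
  ∏ e ∈ Finset.univ.filter (fun e : Fin n × Fin n => G e.1 ≠ G e.2),
    (MvPolynomial.X e.1 - MvPolynomial.X e.2)

theorem eval_crossDiff (G : Fin n → ℕ) (x : Fin n → ℝ) :
    MvPolynomial.eval x (crossDiff G) =
      ∏ e ∈ Finset.univ.filter (fun e : Fin n × Fin n => G e.1 ≠ G e.2), (x e.1 - x e.2) := by
  simp [crossDiff]

theorem eval_crossDiff_ne_zero {G : Fin n → ℕ} {x : Fin n → ℝ} (hx : x ∈ separated G) :
    MvPolynomial.eval x (crossDiff G) ≠ 0 := by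
  rw [eval_crossDiff]
  refine Finset.prod_ne_zero_iff.mpr fun e he => sub_ne_zero.mpr (hx _ _ ?_)
  simpa using he

theorem eval_crossDiff_comp {G : Fin n → ℕ} {σ : Equiv.Perm (Fin n)} (hσ : σ ∈ fiberPerms G)
    (x : Fin n → ℝ) :
    MvPolynomial.eval (x ∘ σ) (crossDiff G) = MvPolynomial.eval x (crossDiff G) := by
  rw [mem_fiberPerms] at hσ
  rw [eval_crossDiff, eval_crossDiff]
  refine Finset.prod_equiv (σ.prodCongr σ) ?_ ?_ <;> simp [hσ]

theorem comp_mem_separated {G : Fin n → ℕ} {σ : Equiv.Perm (Fin n)} (hσ : σ ∈ fiberPerms G)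
    {x : Fin n → ℝ} (hx : x ∈ separated G) : x ∘ σ ∈ separated G := by
  rw [mem_fiberPerms] at hσ
  intro a b hab
  exact hx _ _ (by rwa [hσ, hσ])

/-- The signed sum of `f` is the Vandermonde product of the fibres times a continuous function on
the points separating the fibres. -/
def AlternateDivisible (G : Fin n → ℕ) (f : (Fin n → ℝ) → ℝ) : Prop :=
  ∃ g : (Fin n → ℝ) → ℝ, ContinuousOn g (separated G) ∧
    ∀ x ∈ separated G, alternate G f x = MvPolynomial.eval x (vandermonde G) * g x

theorem AlternateDivisible.const_mul {G : Fin n → ℕ} {f : (Fin n → ℝ) → ℝ}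
    (hf : AlternateDivisible G f) (c : ℝ) : AlternateDivisible G fun x => c * f x := by
  obtain ⟨g, hg, h⟩ := hf
  refine ⟨fun x => c * g x, hg.const_mul c, fun x hx => ?_⟩
  rw [mul_left_comm, ← h x hx, alternate, alternate, Finset.mul_sum]
  exact Finset.sum_congr rfl fun σ _ => mul_left_comm _ _ _

theorem AlternateDivisible.sum {G : Fin n → ℕ} {α : Type*} (s : Finset α)
    {f : α → (Fin n → ℝ) → ℝ} (hf : ∀ a ∈ s, AlternateDivisible G (f a)) :
    AlternateDivisible G fun x => ∑ a ∈ s, f a x := by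
  choose! g hg h using hf
  refine ⟨fun x => ∑ a ∈ s, g a x, continuousOn_finsetSum s hg, fun x hx => ?_⟩
  rw [Finset.mul_sum, ← Finset.sum_congr rfl fun a ha => h a ha x hx]
  simp only [alternate, Finset.mul_sum]
  exact Finset.sum_comm

/-- Rational functions with poles only where coordinates in different fibres collide. -/
theorem alternateDivisible_of_eq_div {G : Fin n → ℕ} {f : (Fin n → ℝ) → ℝ}
    (p : MvPolynomial (Fin n) ℝ) (m : ℕ)
    (hf : ∀ x ∈ separated G,
      f x = MvPolynomial.eval x p / MvPolynomial.eval x (crossDiff G) ^ m) :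
    AlternateDivisible G f := by
  obtain ⟨r, hr⟩ := vandermonde_dvd_alternatePoly G p
  refine ⟨fun x => MvPolynomial.eval x r / MvPolynomial.eval x (crossDiff G) ^ m, ?_, ?_⟩
  · exact r.continuous_eval.continuousOn.div ((crossDiff G).continuous_eval.pow m).continuousOn
      fun x hx => pow_ne_zero _ (eval_crossDiff_ne_zero hx)
  · intro x hx
    rw [← mul_div_assoc, ← map_mul, ← hr, eval_alternatePoly, alternate, alternate,
      Finset.sum_div]
    refine Finset.sum_congr rfl fun σ hσ => ?_
    rw [hf _ (comp_mem_separated hσ hx), eval_crossDiff_comp hσ, mul_div_assoc]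

theorem exists_kernel_eq_div {G : Fin n → ℕ} {a b : Fin n} (hab : G a ≠ G b) :
    ∃ p : MvPolynomial (Fin n) ℝ, ∀ x ∈ separated G,
      1 / (Real.pi * (x a - x b) ^ 2) =
        MvPolynomial.eval x p / MvPolynomial.eval x (crossDiff G) ^ 2 := by
  have hdvd : (MvPolynomial.X a - MvPolynomial.X b : MvPolynomial (Fin n) ℝ) ∣ crossDiff G :=
    Finset.dvd_prod_of_mem
      (fun e : Fin n × Fin n => (MvPolynomial.X e.1 - MvPolynomial.X e.2 : MvPolynomial _ ℝ))
      (a := (a, b)) (by simpa using hab)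
  obtain ⟨r, hr⟩ := hdvd
  refine ⟨MvPolynomial.C Real.pi⁻¹ * r ^ 2, fun x hx => ?_⟩
  have h0 := eval_crossDiff_ne_zero hx
  rw [hr] at h0 ⊢
  simp only [map_mul, map_sub, map_pow, MvPolynomial.eval_X, MvPolynomial.eval_C] at h0 ⊢
  have h1 := left_ne_zero_of_mul h0
  have h2 := right_ne_zero_of_mul h0
  have := Real.pi_ne_zero
  field_simp

/-- A product of kernels over the links of a perfect matching. -/
theorem alternateDivisible_prod_kernel (G : Fin n → ℕ) {κ : Type*} [Fintype κ] {a b : κ → Fin n}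
    (hinj : Function.Injective (Sum.elim a b)) :
    AlternateDivisible G fun x => ∏ k, 1 / (Real.pi * (x (a k) - x (b k)) ^ 2) := by
  have ha : Function.Injective a := hinj.comp Sum.inl_injective
  have hb : Function.Injective b := hinj.comp Sum.inr_injective
  have hab : ∀ k l, a k ≠ b l := fun k l h =>
    Sum.inl_ne_inr (hinj (a₁ := Sum.inl k) (a₂ := Sum.inr l) h)
  by_cases h : ∃ k, G (a k) = G (b k)
  · obtain ⟨k, hk⟩ := h
    refine ⟨0, continuousOn_const, fun x _ => ?_⟩
    rw [Pi.zero_apply, mul_zero]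
    refine alternate_eq_zero (hab k k) hk (fun y => ?_) x
    refine Finset.prod_congr rfl fun l _ => ?_
    obtain rfl | hl := eq_or_ne l k
    · simp only [Function.comp_apply, Equiv.swap_apply_left, Equiv.swap_apply_right]
      rw [sub_sq_comm]
    · simp only [Function.comp_apply]
      rw [Equiv.swap_apply_of_ne_of_ne (ha.ne hl) (hab l k),
        Equiv.swap_apply_of_ne_of_ne (hab k l).symm (hb.ne hl)]
  · push Not at h
    choose p hp using fun k => exists_kernel_eq_div (h k)
    refine alternateDivisible_of_eq_div (∏ k, p k) (2 * Fintype.card κ) fun x hx => ?_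
    rw [Finset.prod_congr rfl fun k _ => hp k x hx, Finset.prod_div_distrib, map_prod,
      Finset.prod_const, pow_mul, Finset.card_univ]

theorem alternateDivisible_Δ {N : ℕ} (G : Fin (2 * N) → ℕ)
    {β : (Fin N → Fin (2 * N)) × (Fin N → Fin (2 * N))}
    (hβ : Function.Injective (Sum.elim β.1 β.2)) :
    AlternateDivisible G fun x => Δ N x β := by
  simp only [Δ, ← Matrix.det_transpose (Matrix.of _), Matrix.det_apply', Matrix.transpose_apply,
    Matrix.of_apply]
  refine AlternateDivisible.sum _ fun τ _ => AlternateDivisible.const_mul ?_ _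
  refine alternateDivisible_prod_kernel G (b := β.2 ∘ τ) ?_
  have : Sum.elim β.1 (β.2 ∘ τ) = Sum.elim β.1 β.2 ∘ Sum.map id τ := by
    rw [Sum.elim_comp_map, Function.comp_id]
  rw [this]
  exact hβ.comp (Function.injective_id.sumMap τ.injective)

end UST17

/-- Lemma 5.12 of the paper: for any finite real-linear combination
`F = Σ_β c_β Δ_β` of Fomin determinants, the antisymmetrization `p_ς F` over each group of
variables equals the product of the intra-group Vandermonde factors times a function `g`
continuous on the open set `U` where variables in different groups are distinct. -/
theorem stmt17 (N d : ℕ) (hN : 0 < N) (hd : 0 < d) (s : ℕ → ℕ)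
    (hs : ∀ i, i < d → 0 < s i) (hsum : UST17.q s d = 2 * N)
    (c : ((Fin N → Fin (2 * N)) × (Fin N → Fin (2 * N))) → ℝ) :
    ∃ g : (Fin (2 * N) → ℝ) → ℝ,
      ContinuousOn g {x : Fin (2 * N) → ℝ | ∀ a b : Fin (2 * N),
        UST17.grp d s (a : ℕ) ≠ UST17.grp d s (b : ℕ) → x a ≠ x b} ∧
      ∀ x : Fin (2 * N) → ℝ,
        (∀ a b : Fin (2 * N), UST17.grp d s (a : ℕ) ≠ UST17.grp d s (b : ℕ) → x a ≠ x b) →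
        Function.Injective x →
        ((1 : ℝ) / ∏ j ∈ Finset.range d, ((s j).factorial : ℝ)) *
            (∑ σ ∈ Finset.univ.filter (fun σ : Equiv.Perm (Fin (2 * N)) =>
                ∀ t : Fin (2 * N), UST17.grp d s ((σ t : ℕ)) = UST17.grp d s (t : ℕ)),
              ((Equiv.Perm.sign σ : ℤ) : ℝ) *
                ∑ β ∈ UST17.LP N, c β * UST17.Δ N (x ∘ σ) β) =
          (∏ i : Fin (2 * N),
              ∏ jj ∈ Finset.univ.filter (fun jj : Fin (2 * N) =>
                i < jj ∧ UST17.grp d s ((jj : ℕ)) = UST17.grp d s ((i : ℕ))),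
                (x jj - x i)) *
            g x := by
  obtain ⟨g, hg, h⟩ : UST17.AlternateDivisible (fun t : Fin (2 * N) => UST17.grp d s t)
      fun x => ∑ β ∈ UST17.LP N, c β * UST17.Δ N x β := by
    refine UST17.AlternateDivisible.sum _ fun β hβ =>
      (UST17.alternateDivisible_Δ _ ?_).const_mul _
    rw [UST17.LP, Finset.mem_filter] at hβ
    exact hβ.2.2.2.1.injective
  refine ⟨fun x => (1 / ∏ j ∈ Finset.range d, ((s j).factorial : ℝ)) * g x, hg.const_mul _,
    fun x hx _ => ?_⟩
  have hV := h x hx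
  simp only [UST17.vandermonde, map_prod, map_sub, MvPolynomial.eval_X] at hV
  rw [mul_left_comm, ← hV]
  rfl
end
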